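/- arXiv:math/0302215 — 3 statements merged into one kernel-verified Lean document; each statement's English description precedes it below -/
import Mathlib

section
/- Let (x₁, x₂, x₃, y₁, y₂, z₁) be a 6-tuple of real numbers satisfying: x₁ < y₁ < x₂ < y₂ < x₃; y₁ < z₁ < y₂; y₁ − x₁ < min(x₂ − y₁, √((z₁ − y₁)² + 2(z₁ − y₁)·|z₁ − x₂|)); and x₃ − y₂ < min(y₂ − x₂, √((y₂ − z₁)² + 2(y₂ − z₁)·|z₁ − x₂|)). Then there exists an open interval I containing all six points and a 3-nice function f on I such that the set of zeros of f in I is {x₁, x₂, x₃}, the set of zeros of f' in I is {y₁, y₂}, and the set of zeros of f'' in I is {z₁}. -/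
open Set

/-- `f` is `n`-nice on `I`: it is smooth on `I` and for each `i = 0, …, n`
the `i`-th derivative of `f` has exactly `n - i` zeros in `I`. -/
def IsNNice (n : ℕ) (f : ℝ → ℝ) (I : Set ℝ) : Prop :=
  ContDiffOn ℝ (⊤ : ℕ∞) f I ∧
  ∀ i ≤ n, {x ∈ I | iteratedDeriv i f x = 0}.encard = ((n - i : ℕ) : ℕ∞)

open scoped ContDiff Topology

/-- `f` is smooth on the real line with successive derivatives `f₁`, `f₂`, `f₃`. -/
structure IsThreeJet (f f₁ f₂ f₃ : ℝ → ℝ) : Prop where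
  contDiff : ContDiff ℝ ∞ f
  hasDerivAt₀ : ∀ x, HasDerivAt f (f₁ x) x
  hasDerivAt₁ : ∀ x, HasDerivAt f₁ (f₂ x) x
  hasDerivAt₂ : ∀ x, HasDerivAt f₂ (f₃ x) x

namespace IsThreeJet

variable {f f₁ f₂ f₃ g g₁ g₂ g₃ : ℝ → ℝ}

theorem add (hf : IsThreeJet f f₁ f₂ f₃) (hg : IsThreeJet g g₁ g₂ g₃) :
    IsThreeJet (fun x => f x + g x) (fun x => f₁ x + g₁ x) (fun x => f₂ x + g₂ x)
      (fun x => f₃ x + g₃ x) :=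
  ⟨hf.contDiff.add hg.contDiff, fun x => (hf.hasDerivAt₀ x).add (hg.hasDerivAt₀ x),
    fun x => (hf.hasDerivAt₁ x).add (hg.hasDerivAt₁ x),
    fun x => (hf.hasDerivAt₂ x).add (hg.hasDerivAt₂ x)⟩

theorem const_mul_comp_affine (hf : IsThreeJet f f₁ f₂ f₃) (a k c : ℝ) :
    IsThreeJet (fun x => a * f (k * (x - c))) (fun x => a * k * f₁ (k * (x - c)))
      (fun x => a * k ^ 2 * f₂ (k * (x - c))) (fun x => a * k ^ 3 * f₃ (k * (x - c))) := by
  have key : ∀ {u v : ℝ → ℝ}, (∀ x, HasDerivAt u (v x) x) → ∀ s x : ℝ,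
      HasDerivAt (fun x => s * u (k * (x - c))) (s * k * v (k * (x - c))) x := by
    intro u v h s x
    have h1 : HasDerivAt (fun x : ℝ => k * (x - c)) k x := by
      simpa using ((hasDerivAt_id x).sub_const c).const_mul k
    exact (((h (k * (x - c))).comp x h1).const_mul s).congr_deriv (by ring)
  refine ⟨?_, key hf.hasDerivAt₀ a, fun x => ?_, fun x => ?_⟩
  · exact contDiff_const.mul
      (hf.contDiff.comp (contDiff_const.mul (contDiff_id.sub contDiff_const)))
  · convert key hf.hasDerivAt₁ (a * k) x using 1
    ring
  · convert key hf.hasDerivAt₂ (a * k ^ 2) x using 1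
    ring

end IsThreeJet

theorem isThreeJet_cubic (e c s : ℝ) :
    IsThreeJet (fun x => e / 3 * (x - c) ^ 3 - x + s) (fun x => e * (x - c) ^ 2 - 1)
      (fun x => 2 * e * (x - c)) (fun _ => 2 * e) := by
  have h1 : ∀ x : ℝ, HasDerivAt (fun x : ℝ => x - c) 1 x := fun x =>
    (hasDerivAt_id x).sub_const c
  refine ⟨by fun_prop, fun x => ?_, fun x => ?_, fun x => ?_⟩
  · exact (((((h1 x).pow 3).const_mul (e / 3)).sub (hasDerivAt_id x)).add_const s).congr_deriv
      (by norm_num; ring)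
  · exact ((((h1 x).pow 2).const_mul e).sub_const 1).congr_deriv (by norm_num; ring)
  · simpa using (h1 x).const_mul (2 * e)

/-- The zeros of a smooth function with positive third derivative and of its first two
derivatives are determined by three, two and one known zeros respectively. -/
theorem IsThreeJet.zeros_eq {f f₁ f₂ f₃ : ℝ → ℝ} (hf : IsThreeJet f f₁ f₂ f₃)
    (hpos : ∀ x, 0 < f₃ x) {x₁ x₂ x₃ y₁ y₂ z : ℝ}
    (h₁ : x₁ ≤ y₁) (h₂ : y₁ ≤ x₂) (h₃ : x₂ ≤ y₂) (h₄ : y₂ ≤ x₃) (h₅ : y₁ ≤ z) (h₆ : z ≤ y₂)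
    (hx₁ : f x₁ = 0) (hx₂ : f x₂ = 0) (hx₃ : f x₃ = 0) (hy₁ : f₁ y₁ = 0) (hy₂ : f₁ y₂ = 0)
    (hz : f₂ z = 0) :
    (∀ x, f x = 0 ↔ x = x₁ ∨ x = x₂ ∨ x = x₃) ∧ (∀ x, f₁ x = 0 ↔ x = y₁ ∨ x = y₂) ∧
      ∀ x, f₂ x = 0 ↔ x = z := by
  have m2 : StrictMono f₂ := strictMono_of_hasDerivAt_pos hf.hasDerivAt₂ hpos
  have c1 : Continuous f₁ := continuous_iff_continuousAt.2 fun x => (hf.hasDerivAt₁ x).continuousAt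
  have c0 : Continuous f := hf.contDiff.continuous
  have d1 : ∀ x, deriv f₁ x = f₂ x := fun x => (hf.hasDerivAt₁ x).deriv
  have d0 : ∀ x, deriv f x = f₁ x := fun x => (hf.hasDerivAt₀ x).deriv
  have a1 : StrictAntiOn f₁ (Iic z) := by
    refine strictAntiOn_of_deriv_neg (convex_Iic z) c1.continuousOn fun x hx => ?_
    rw [interior_Iic] at hx
    rw [d1, ← hz]
    exact m2 hx
  have m1 : StrictMonoOn f₁ (Ici z) := by
    refine strictMonoOn_of_deriv_pos (convex_Ici z) c1.continuousOn fun x hx => ?_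
    rw [interior_Ici] at hx
    rw [d1, ← hz]
    exact m2 hx
  have l0 : StrictMonoOn f (Iic y₁) := by
    refine strictMonoOn_of_deriv_pos (convex_Iic y₁) c0.continuousOn fun x hx => ?_
    rw [interior_Iic] at hx
    rw [d0, ← hy₁]
    exact a1 (le_trans (le_of_lt hx) h₅) h₅ hx
  have r0 : StrictMonoOn f (Ici y₂) := by
    refine strictMonoOn_of_deriv_pos (convex_Ici y₂) c0.continuousOn fun x hx => ?_
    rw [interior_Ici] at hx
    rw [d0, ← hy₂]
    exact m1 h₆ (le_trans h₆ (le_of_lt hx)) hx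
  have a0 : StrictAntiOn f (Icc y₁ y₂) := by
    refine strictAntiOn_of_deriv_neg (convex_Icc y₁ y₂) c0.continuousOn fun x hx => ?_
    rw [interior_Icc] at hx
    rw [d0]
    rcases le_total x z with h | h
    · rw [← hy₁]
      exact a1 h₅ h hx.1
    · rw [← hy₂]
      exact m1 h h₆ hx.2
  refine ⟨fun x => ⟨fun hx => ?_, ?_⟩, fun x => ⟨fun hx => ?_, ?_⟩,
    fun x => ⟨fun hx => m2.injective (hx.trans hz.symm), ?_⟩⟩
  · rcases le_total x y₁ with h | h
    · exact Or.inl (l0.injOn h h₁ (hx.trans hx₁.symm))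
    rcases le_total x y₂ with h' | h'
    · exact Or.inr (Or.inl (a0.injOn ⟨h, h'⟩ ⟨h₂, h₃⟩ (hx.trans hx₂.symm)))
    · exact Or.inr (Or.inr (r0.injOn h' h₄ (hx.trans hx₃.symm)))
  · rintro (rfl | rfl | rfl) <;> assumption
  · rcases le_total x z with h | h
    · exact Or.inl (a1.injOn h h₅ (hx.trans hy₁.symm))
    · exact Or.inr (m1.injOn h h₆ (hx.trans hy₂.symm))
  · rintro (rfl | rfl) <;> assumption
  · rintro rfl
    exact hz

/-- A smooth convex approximation of `x ↦ max x 0`. -/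
noncomputable def smoothRamp (x : ℝ) : ℝ := ∫ t in (0 : ℝ)..x, Real.smoothTransition t

/-- The primitive of `smoothRamp` vanishing at `0`. -/
noncomputable def smoothRampPrimitive (x : ℝ) : ℝ := ∫ t in (0 : ℝ)..x, smoothRamp t

theorem hasDerivAt_smoothRamp (x : ℝ) :
    HasDerivAt smoothRamp (Real.smoothTransition x) x :=
  (Real.smoothTransition.continuous.integral_hasStrictDerivAt 0 x).hasDerivAt

theorem continuous_smoothRamp : Continuous smoothRamp :=
  continuous_iff_continuousAt.2 fun x => (hasDerivAt_smoothRamp x).continuousAt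

theorem hasDerivAt_smoothRampPrimitive (x : ℝ) :
    HasDerivAt smoothRampPrimitive (smoothRamp x) x :=
  (continuous_smoothRamp.integral_hasStrictDerivAt 0 x).hasDerivAt

theorem contDiff_infty_of_hasDerivAt {f f' : ℝ → ℝ} (h : ∀ x, HasDerivAt f (f' x) x)
    (hf' : ContDiff ℝ ∞ f') : ContDiff ℝ ∞ f := by
  refine contDiff_infty_iff_deriv.2 ⟨fun x => (h x).differentiableAt, ?_⟩
  rwa [show deriv f = f' from funext fun x => (h x).deriv]

theorem isThreeJet_smoothRampPrimitive :
    IsThreeJet smoothRampPrimitive smoothRamp Real.smoothTransition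
      (deriv Real.smoothTransition) where
  contDiff := contDiff_infty_of_hasDerivAt hasDerivAt_smoothRampPrimitive
    (contDiff_infty_of_hasDerivAt hasDerivAt_smoothRamp Real.smoothTransition.contDiff)
  hasDerivAt₀ := hasDerivAt_smoothRampPrimitive
  hasDerivAt₁ := hasDerivAt_smoothRamp
  hasDerivAt₂ x := ((Real.smoothTransition.contDiff (n := 1)).differentiable
    (by norm_num) x).hasDerivAt

theorem smoothRamp_of_nonpos {x : ℝ} (hx : x ≤ 0) : smoothRamp x = 0 := by
  refine intervalIntegral.integral_zero_ae (Filter.Eventually.of_forall fun t ht => ?_)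
  rw [uIoc_of_ge hx] at ht
  exact Real.smoothTransition.zero_of_nonpos ht.2

theorem smoothRampPrimitive_of_nonpos {x : ℝ} (hx : x ≤ 0) : smoothRampPrimitive x = 0 := by
  refine intervalIntegral.integral_zero_ae (Filter.Eventually.of_forall fun t ht => ?_)
  rw [uIoc_of_ge hx] at ht
  exact smoothRamp_of_nonpos ht.2

theorem smoothRamp_pos {x : ℝ} (hx : 0 < x) : 0 < smoothRamp x :=
  intervalIntegral.intervalIntegral_pos_of_pos_on
    (Real.smoothTransition.continuous.intervalIntegrable 0 x)
    (fun _ ht => Real.smoothTransition.pos_of_pos ht.1) hx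

theorem smoothRampPrimitive_pos {x : ℝ} (hx : 0 < x) : 0 < smoothRampPrimitive x :=
  intervalIntegral.intervalIntegral_pos_of_pos_on
    (continuous_smoothRamp.intervalIntegrable 0 x) (fun _ ht => smoothRamp_pos ht.1) hx

theorem smoothRamp_le {x : ℝ} (hx : 0 ≤ x) : smoothRamp x ≤ x := by
  have h := intervalIntegral.integral_mono_on (μ := MeasureTheory.volume) hx
    (Real.smoothTransition.continuous.intervalIntegrable 0 x)
    (intervalIntegrable_const (c := (1 : ℝ))) (fun t _ => Real.smoothTransition.le_one t)
  simpa [smoothRamp] using h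

theorem smoothRampPrimitive_le {x : ℝ} (hx : 0 ≤ x) : smoothRampPrimitive x ≤ x ^ 2 / 2 := by
  have h := intervalIntegral.integral_mono_on (μ := MeasureTheory.volume) hx
    (continuous_smoothRamp.intervalIntegrable 0 x)
    (continuous_id.intervalIntegrable _ _) (fun t ht => smoothRamp_le ht.1)
  simpa [smoothRampPrimitive] using h

theorem sub_one_le_smoothRamp {x : ℝ} (hx : 1 ≤ x) : x - 1 ≤ smoothRamp x := by
  have hI : ∀ a b : ℝ, IntervalIntegrable Real.smoothTransition MeasureTheory.volume a b :=
    fun a b => Real.smoothTransition.continuous.intervalIntegrable a b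
  have h : ∫ t in (1 : ℝ)..x, Real.smoothTransition t = x - 1 := by
    rw [intervalIntegral.integral_congr (g := fun _ => (1 : ℝ)) fun t ht => ?_]
    · simp
    · rw [uIcc_of_le hx] at ht
      exact Real.smoothTransition.one_of_one_le ht.1
  have h0 : 0 < smoothRamp 1 := smoothRamp_pos one_pos
  have hadd : smoothRamp 1 + ∫ t in (1 : ℝ)..x, Real.smoothTransition t = smoothRamp x :=
    intervalIntegral.integral_add_adjacent_intervals (hI 0 1) (hI 1 x)
  linarith

theorem deriv_smoothTransition_nonneg (x : ℝ) : 0 ≤ deriv Real.smoothTransition x :=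
  Real.smoothTransition.monotone.deriv_nonneg

/-- A multiple of `smoothRampPrimitive` normalised so that its derivative equals `t ≤ 1` at `p`,
after rescaling by `1 / e`, is bounded by the primitive of a steeper piecewise linear ramp. -/
theorem rescaled_smoothRampPrimitive_le {e p t s : ℝ} (he : 0 < e) (hp : e < p)
    (ht1 : t ≤ 1) (hs : 0 ≤ s) :
    t / (1 / e * smoothRamp (1 / e * p)) * smoothRampPrimitive (1 / e * s) ≤
      s ^ 2 / (2 * (p - e)) := by
  have h1 : 1 ≤ 1 / e * p := by
    rw [one_div_mul_eq_div, le_div_iff₀ he]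
    linarith
  have h2 := sub_one_le_smoothRamp h1
  have hpe : 0 < p - e := by linarith
  have h3 : (p - e) / e ^ 2 ≤ 1 / e * smoothRamp (1 / e * p) := by
    have : (p - e) / e ^ 2 = 1 / e * (1 / e * p - 1) := by
      field_simp
    rw [this]
    gcongr
  have h4 := smoothRampPrimitive_le (x := 1 / e * s) (by positivity)
  have h5 : 0 ≤ smoothRampPrimitive (1 / e * s) := by
    rcases hs.eq_or_lt with h | h
    · rw [← h, mul_zero, smoothRampPrimitive_of_nonpos le_rfl]
    · exact (smoothRampPrimitive_pos (by positivity)).le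
  calc _ ≤ 1 / ((p - e) / e ^ 2) * ((1 / e * s) ^ 2 / 2) := by gcongr
    _ = s ^ 2 / (2 * (p - e)) := by
      field_simp

theorem eventually_pos_nhdsGT_zero {g : ℝ → ℝ} (hg : ContinuousAt g 0) (h : 0 < g 0) :
    ∀ᶠ e in 𝓝[>] (0 : ℝ), 0 < g e :=
  (hg.eventually (lt_mem_nhds h)).filter_mono nhdsWithin_le_nhds

/-- The construction when the zero of `f₂` lies weakly to the left of the middle zero of `f`. -/
theorem exists_isThreeJet_of_le {x₁ x₂ x₃ y₁ y₂ z : ℝ}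
    (h₁ : x₁ < y₁) (h₃ : x₂ < y₂) (h₄ : y₂ < x₃) (h₅ : y₁ < z) (h₆ : z ≤ x₂)
    (h₇ : (y₁ - x₁) ^ 2 < (z - y₁) ^ 2 + 2 * (z - y₁) * (x₂ - z))
    (h₈ : x₃ - y₂ < y₂ - x₂) :
    ∃ f f₁ f₂ f₃ : ℝ → ℝ, IsThreeJet f f₁ f₂ f₃ ∧ (∀ x, 0 < f₃ x) ∧
      f x₁ = 0 ∧ f x₂ = 0 ∧ f x₃ = 0 ∧ f₁ y₁ = 0 ∧ f₁ y₂ = 0 ∧ f₂ z = 0 := by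
  have hp : 0 < z - y₁ := by linarith
  have hr : 0 < y₂ - x₂ := by linarith
  have E1 : ∀ᶠ e in 𝓝[>] (0 : ℝ),
      0 < x₂ - x₁ - (z - x₁) ^ 2 / (2 * (z - y₁ - e)) - e / 3 * ((z - x₁) ^ 3 + (x₂ - z) ^ 3) := by
    refine eventually_pos_nhdsGT_zero ?_ ?_
    · have : 2 * (z - y₁ - 0) ≠ 0 := by simpa using hp.ne'
      fun_prop (disch := assumption)
    · have : (z - x₁) ^ 2 / (2 * (z - y₁ - 0)) < x₂ - x₁ := by
        rw [div_lt_iff₀ (by linarith)]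
        nlinarith
      linarith
  have E2 : ∀ᶠ e in 𝓝[>] (0 : ℝ),
      0 < x₃ - x₂ - (x₃ - x₂) ^ 2 / (2 * (y₂ - x₂ - e)) -
        e / 3 * ((x₃ - z) ^ 3 - (x₂ - z) ^ 3) := by
    refine eventually_pos_nhdsGT_zero ?_ ?_
    · have : 2 * (y₂ - x₂ - 0) ≠ 0 := by simpa using hr.ne'
      fun_prop (disch := assumption)
    · have : (x₃ - x₂) ^ 2 / (2 * (y₂ - x₂ - 0)) < x₃ - x₂ := by
        rw [div_lt_iff₀ (by linarith)]
        nlinarith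
      linarith
  have E3 : ∀ᶠ e in 𝓝[>] (0 : ℝ), 0 < z - y₁ - e :=
    eventually_pos_nhdsGT_zero (by fun_prop) (by linarith)
  have E4 : ∀ᶠ e in 𝓝[>] (0 : ℝ), 0 < y₂ - x₂ - e :=
    eventually_pos_nhdsGT_zero (by fun_prop) (by linarith)
  have E5 : ∀ᶠ e in 𝓝[>] (0 : ℝ), 0 < 1 - e * (y₁ - z) ^ 2 :=
    eventually_pos_nhdsGT_zero (by fun_prop) (by simp)
  have E6 : ∀ᶠ e in 𝓝[>] (0 : ℝ), 0 < 1 - e * (y₂ - z) ^ 2 :=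
    eventually_pos_nhdsGT_zero (by fun_prop) (by simp)
  obtain ⟨e, e1, e2, e3, e4, e5, e6, he⟩ := (E1.and <| E2.and <| E3.and <| E4.and <| E5.and <|
    E6.and self_mem_nhdsWithin).exists
  replace he : 0 < e := he
  have hk : 0 < 1 / e := by positivity
  have hα := rescaled_smoothRampPrimitive_le (t := 1 - e * (y₁ - z) ^ 2) (s := z - x₁) he
    (p := z - y₁) (by linarith) (sub_le_self _ (by positivity)) (by linarith)
  have hβ := rescaled_smoothRampPrimitive_le (t := 1 - e * (y₂ - z) ^ 2) (s := x₃ - x₂) he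
    (p := y₂ - x₂) (by linarith) (sub_le_self _ (by positivity)) (by linarith)
  have hψp : 0 < smoothRamp (1 / e * (z - y₁)) := smoothRamp_pos (by positivity)
  have hψr : 0 < smoothRamp (1 / e * (y₂ - x₂)) := smoothRamp_pos (by positivity)
  set k := 1 / e
  set a := (1 - e * (y₁ - z) ^ 2) / (k * smoothRamp (k * (z - y₁))) with ha
  set b := (1 - e * (y₂ - z) ^ 2) / (k * smoothRamp (k * (y₂ - x₂))) with hb
  have ha0 : 0 < a := by positivity
  have hb0 : 0 < b := by positivity
  have haeq : a * k * smoothRamp (k * (z - y₁)) = 1 - e * (y₁ - z) ^ 2 := by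
    rw [ha]
    field_simp
  have hbeq : b * k * smoothRamp (k * (y₂ - x₂)) = 1 - e * (y₂ - z) ^ 2 := by
    rw [hb]
    field_simp
  have hu : 0 < smoothRampPrimitive (y₁ - x₁) := smoothRampPrimitive_pos (by linarith)
  have hw : 0 < smoothRampPrimitive (x₃ - y₂) := smoothRampPrimitive_pos (by linarith)
  obtain ⟨l, hl, hleq⟩ : ∃ l, 0 < l ∧ l * smoothRampPrimitive (y₁ - x₁) =
      x₂ - x₁ - a * smoothRampPrimitive (k * (z - x₁)) -
        e / 3 * ((z - x₁) ^ 3 + (x₂ - z) ^ 3) :=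
    ⟨_, div_pos (by linarith) hu, div_mul_cancel₀ _ hu.ne'⟩
  obtain ⟨m, hm, hmeq⟩ : ∃ m, 0 < m ∧ m * smoothRampPrimitive (x₃ - y₂) =
      x₃ - x₂ - b * smoothRampPrimitive (k * (x₃ - x₂)) -
        e / 3 * ((x₃ - z) ^ 3 - (x₂ - z) ^ 3) :=
    ⟨_, div_pos (by linarith) hw, div_mul_cancel₀ _ hw.ne'⟩
  have J := isThreeJet_smoothRampPrimitive
  refine ⟨_, _, _, _, ((((J.const_mul_comp_affine (-a) (-k) z).add
    (J.const_mul_comp_affine b k x₂)).add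
    (isThreeJet_cubic e z (x₂ - e / 3 * (x₂ - z) ^ 3))).add
    (J.const_mul_comp_affine (-l) (-1) y₁)).add (J.const_mul_comp_affine m 1 y₂),
    fun x => ?_, ?_, ?_, ?_, ?_, ?_, ?_⟩
  · have q1 := deriv_smoothTransition_nonneg (-k * (x - z))
    have q2 := deriv_smoothTransition_nonneg (k * (x - x₂))
    have q3 := deriv_smoothTransition_nonneg (-1 * (x - y₁))
    have q4 := deriv_smoothTransition_nonneg (1 * (x - y₂))
    have s1 : -a * (-k) ^ 3 = a * k ^ 3 := by ring
    have s3 : -l * (-1) ^ 3 = l := by ring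
    simp only [s1, s3]
    positivity
  · simp only [smoothRampPrimitive_of_nonpos (x := k * (x₁ - x₂))
        (mul_nonpos_of_nonneg_of_nonpos hk.le (by linarith)),
      smoothRampPrimitive_of_nonpos (x := 1 * (x₁ - y₂)) (by linarith),
      show -k * (x₁ - z) = k * (z - x₁) by ring, show -1 * (x₁ - y₁) = y₁ - x₁ by ring]
    linear_combination -hleq
  · simp only [smoothRampPrimitive_of_nonpos (x := k * (x₂ - x₂)) (by simp),
      smoothRampPrimitive_of_nonpos (x := 1 * (x₂ - y₂)) (by linarith),
      smoothRampPrimitive_of_nonpos (x := -k * (x₂ - z))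
        (mul_nonpos_of_nonpos_of_nonneg (by linarith) (by linarith)),
      smoothRampPrimitive_of_nonpos (x := -1 * (x₂ - y₁)) (by linarith)]
    ring
  · simp only [smoothRampPrimitive_of_nonpos (x := -k * (x₃ - z))
        (mul_nonpos_of_nonpos_of_nonneg (by linarith) (by linarith)),
      smoothRampPrimitive_of_nonpos (x := -1 * (x₃ - y₁)) (by linarith), one_mul]
    linear_combination hmeq
  · simp only [smoothRamp_of_nonpos (x := k * (y₁ - x₂))
        (mul_nonpos_of_nonneg_of_nonpos hk.le (by linarith)),
      smoothRamp_of_nonpos (x := 1 * (y₁ - y₂)) (by linarith),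
      smoothRamp_of_nonpos (x := -1 * (y₁ - y₁)) (by simp),
      show -k * (y₁ - z) = k * (z - y₁) by ring]
    linear_combination haeq
  · simp only [smoothRamp_of_nonpos (x := -k * (y₂ - z))
        (mul_nonpos_of_nonpos_of_nonneg (by linarith) (by linarith)),
      smoothRamp_of_nonpos (x := 1 * (y₂ - y₂)) (by simp),
      smoothRamp_of_nonpos (x := -1 * (y₂ - y₁)) (by linarith)]
    linear_combination hbeq
  · simp only [Real.smoothTransition.zero_of_nonpos (x := k * (z - x₂))
        (mul_nonpos_of_nonneg_of_nonpos hk.le (by linarith)),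
      Real.smoothTransition.zero_of_nonpos (x := 1 * (z - y₂)) (by linarith),
      Real.smoothTransition.zero_of_nonpos (x := -k * (z - z)) (by simp),
      Real.smoothTransition.zero_of_nonpos (x := -1 * (z - y₁)) (by linarith)]
    ring

theorem exists_isThreeJet {x₁ x₂ x₃ y₁ y₂ z : ℝ}
    (h₁ : x₁ < y₁) (h₂ : y₁ < x₂) (h₃ : x₂ < y₂) (h₄ : y₂ < x₃) (h₅ : y₁ < z) (h₆ : z < y₂)
    (h₇ : y₁ - x₁ < min (x₂ - y₁)
      (Real.sqrt ((z - y₁) ^ 2 + 2 * (z - y₁) * |z - x₂|)))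
    (h₈ : x₃ - y₂ < min (y₂ - x₂)
      (Real.sqrt ((y₂ - z) ^ 2 + 2 * (y₂ - z) * |z - x₂|))) :
    ∃ f f₁ f₂ f₃ : ℝ → ℝ, IsThreeJet f f₁ f₂ f₃ ∧ (∀ x, 0 < f₃ x) ∧
      f x₁ = 0 ∧ f x₂ = 0 ∧ f x₃ = 0 ∧ f₁ y₁ = 0 ∧ f₁ y₂ = 0 ∧ f₂ z = 0 := by
  rw [lt_min_iff, Real.lt_sqrt (by linarith)] at h₇ h₈
  rcases le_total z x₂ with h | h
  · rw [abs_of_nonpos (by linarith), neg_sub] at h₇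
    exact exists_isThreeJet_of_le h₁ h₃ h₄ h₅ h h₇.2 h₈.1
  · rw [abs_of_nonneg (by linarith)] at h₈
    obtain ⟨f, f₁, f₂, f₃, hf, hpos, e1, e2, e3, e4, e5, e6⟩ :=
      exists_isThreeJet_of_le (x₁ := -x₃) (x₂ := -x₂) (x₃ := -x₁) (y₁ := -y₂) (y₂ := -y₁)
        (z := -z) (neg_lt_neg h₄) (neg_lt_neg h₂) (neg_lt_neg h₁) (neg_lt_neg h₆) (neg_le_neg h)
        (by linarith [h₈.2]) (by linarith [h₇.1])
    refine ⟨_, _, _, _, hf.const_mul_comp_affine (-1) (-1) 0, fun x => ?_, ?_⟩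
    · simpa [Odd.neg_one_pow (show Odd 3 by decide)] using hpos (-x)
    · simp [*]

/-- **Inequality Theorem (sufficiency).** Any 6-tuple satisfying the
inequalities `(2)` is the arrangement of zeros of `f, f', f''` for some
`3`-nice function `f`. -/
theorem inequality_theorem_sufficiency
    (x₁ x₂ x₃ y₁ y₂ z₁ : ℝ)
    (h₁ : x₁ < y₁) (h₂ : y₁ < x₂) (h₃ : x₂ < y₂) (h₄ : y₂ < x₃)
    (h₅ : y₁ < z₁) (h₆ : z₁ < y₂)
    (h₇ : y₁ - x₁ < min (x₂ - y₁)
      (Real.sqrt ((z₁ - y₁) ^ 2 + 2 * (z₁ - y₁) * |z₁ - x₂|)))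
    (h₈ : x₃ - y₂ < min (y₂ - x₂)
      (Real.sqrt ((y₂ - z₁) ^ 2 + 2 * (y₂ - z₁) * |z₁ - x₂|))) :
    ∃ a b : ℝ, x₁ ∈ Set.Ioo a b ∧ x₂ ∈ Set.Ioo a b ∧ x₃ ∈ Set.Ioo a b ∧
      y₁ ∈ Set.Ioo a b ∧ y₂ ∈ Set.Ioo a b ∧ z₁ ∈ Set.Ioo a b ∧
      ∃ f : ℝ → ℝ, IsNNice 3 f (Set.Ioo a b) ∧
        {x ∈ Set.Ioo a b | f x = 0} = {x₁, x₂, x₃} ∧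
        {x ∈ Set.Ioo a b | deriv f x = 0} = {y₁, y₂} ∧
        {x ∈ Set.Ioo a b | iteratedDeriv 2 f x = 0} = {z₁} := by
  obtain ⟨f, f₁, f₂, f₃, hf, hpos, e1, e2, e3, e4, e5, e6⟩ :=
    exists_isThreeJet h₁ h₂ h₃ h₄ h₅ h₆ h₇ h₈
  obtain ⟨r0, r1, r2⟩ :=
    hf.zeros_eq hpos h₁.le h₂.le h₃.le h₄.le h₅.le h₆.le e1 e2 e3 e4 e5 e6
  have d1 : deriv f = f₁ := funext fun x => (hf.hasDerivAt₀ x).deriv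
  have d2 : deriv f₁ = f₂ := funext fun x => (hf.hasDerivAt₁ x).deriv
  have d3 : deriv f₂ = f₃ := funext fun x => (hf.hasDerivAt₂ x).deriv
  have i1 : iteratedDeriv 1 f = f₁ := by rw [iteratedDeriv_one, d1]
  have i2 : iteratedDeriv 2 f = f₂ := by rw [iteratedDeriv_succ, i1, d2]
  have i3 : iteratedDeriv 3 f = f₃ := by rw [iteratedDeriv_succ, i2, d3]
  have m1 : x₁ ∈ Ioo (x₁ - 1) (x₃ + 1) := ⟨by linarith, by linarith⟩
  have m2 : x₂ ∈ Ioo (x₁ - 1) (x₃ + 1) := ⟨by linarith, by linarith⟩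
  have m3 : x₃ ∈ Ioo (x₁ - 1) (x₃ + 1) := ⟨by linarith, by linarith⟩
  have m4 : y₁ ∈ Ioo (x₁ - 1) (x₃ + 1) := ⟨by linarith, by linarith⟩
  have m5 : y₂ ∈ Ioo (x₁ - 1) (x₃ + 1) := ⟨by linarith, by linarith⟩
  have m6 : z₁ ∈ Ioo (x₁ - 1) (x₃ + 1) := ⟨by linarith, by linarith⟩
  have s0 : {x ∈ Ioo (x₁ - 1) (x₃ + 1) | f x = 0} = {x₁, x₂, x₃} := by
    ext x
    simp only [mem_ofPred_eq, mem_insert_iff, mem_singleton_iff, r0]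
    exact ⟨fun h => h.2, fun h => ⟨by rcases h with rfl | rfl | rfl <;> assumption, h⟩⟩
  have s1 : {x ∈ Ioo (x₁ - 1) (x₃ + 1) | f₁ x = 0} = {y₁, y₂} := by
    ext x
    simp only [mem_ofPred_eq, mem_insert_iff, mem_singleton_iff, r1]
    exact ⟨fun h => h.2, fun h => ⟨by rcases h with rfl | rfl <;> assumption, h⟩⟩
  have s2 : {x ∈ Ioo (x₁ - 1) (x₃ + 1) | f₂ x = 0} = {z₁} := by
    ext x
    simp only [mem_ofPred_eq, mem_singleton_iff, r2]
    exact ⟨fun h => h.2, fun h => ⟨h ▸ m6, h⟩⟩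
  have s3 : {x ∈ Ioo (x₁ - 1) (x₃ + 1) | f₃ x = 0} = ∅ := by
    ext x
    simp [(hpos x).ne']
  refine ⟨x₁ - 1, x₃ + 1, m1, m2, m3, m4, m5, m6, f, ⟨hf.contDiff.contDiffOn, fun i hi => ?_⟩,
    s0, d1 ▸ s1, i2 ▸ s2⟩
  interval_cases i
  · rw [iteratedDeriv_zero, s0, encard_insert_of_notMem, encard_pair (ne_of_lt (by linarith))]
    · norm_num
    · simp only [mem_insert_iff, mem_singleton_iff, not_or]
      exact ⟨ne_of_lt (by linarith), ne_of_lt (by linarith)⟩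
  · rw [i1, s1, encard_pair (ne_of_lt (by linarith))]
    norm_num
  · rw [i2, s2, encard_singleton]
    norm_num
  · rw [i3, s3, encard_empty]
    norm_num
end

section
/- (Pólya–Wiener) Let f : ℝ → ℝ be a smooth 2π-periodic function such that the number of zeros of f⁽ⁱ⁾ in a period [0, 2π) remains bounded as i → ∞ (i.e., there exists N such that for every i ≥ 0 the i-th derivative f⁽ⁱ⁾ has at most N zeros in [0, 2π)). Then f is a trigonometric polynomial: there exist n ≥ 0 and real numbers a₀, a₁, …, aₙ, b₁, …, bₙ such that f(x) = a₀ + Σ_{k=1}^{n} (aₖ cos kx + bₖ sin kx) for all x. -/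
open Set Real Filter Topology

/-- The real part of the exponential series `∑ d k * exp (i k x)`. -/
noncomputable def trigSeries (d : ℕ → ℂ) (x : ℝ) : ℝ :=
  ∑' k : ℕ, (d k * Complex.exp (k * x * Complex.I)).re

/-- A sequence that stays summable after multiplication by any power of the index. -/
def RapidDecay (d : ℕ → ℂ) : Prop :=
  ∀ j : ℕ, Summable fun k : ℕ => (k : ℝ) ^ j * ‖d k‖

/-- `g` vanishes at `k` cyclically ordered points of a period `2π`. -/
def HasCyclicZeros (g : ℝ → ℝ) (k : ℕ) : Prop :=
  ∃ z : ℕ → ℝ, (∀ i < k, z i < z (i + 1)) ∧ z k = z 0 + 2 * π ∧ ∀ i < k, g (z i) = 0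

theorem RapidDecay.of_norm_le {d e : ℕ → ℂ} (hd : RapidDecay d) {A B : ℝ}
    (h : ∀ k : ℕ, ‖e k‖ ≤ (A + B * k) * ‖d k‖) : RapidDecay e := by
  intro j
  refine Summable.of_nonneg_of_le (fun k => by positivity) (fun k => ?_)
    (((hd j).mul_left A).add ((hd (j + 1)).mul_left B))
  calc (k : ℝ) ^ j * ‖e k‖ ≤ (k : ℝ) ^ j * ((A + B * k) * ‖d k‖) := by gcongr; exact h k
    _ = _ := by ring

theorem RapidDecay.summable_norm {d : ℕ → ℂ} (hd : RapidDecay d) :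
    Summable fun k => ‖d k‖ := by
  simpa using hd 0

theorem norm_re_mul_exp_le (z : ℂ) (k : ℕ) (x : ℝ) :
    ‖(z * Complex.exp (k * x * Complex.I)).re‖ ≤ ‖z‖ := by
  refine (Complex.abs_re_le_norm _).trans ?_
  have := Complex.norm_exp_ofReal_mul_I (k * x)
  push_cast at this
  rw [norm_mul, this, mul_one]

theorem RapidDecay.summable {d : ℕ → ℂ} (hd : RapidDecay d) (x : ℝ) :
    Summable fun k : ℕ => (d k * Complex.exp (k * x * Complex.I)).re :=
  .of_norm_bounded hd.summable_norm fun k => norm_re_mul_exp_le _ k x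

theorem RapidDecay.index_mul {d : ℕ → ℂ} (hd : RapidDecay d) :
    RapidDecay fun k => k * Complex.I * d k :=
  hd.of_norm_le (A := 0) (B := 1) fun k => by simp

theorem RapidDecay.hasDerivAt {d : ℕ → ℂ} (hd : RapidDecay d) (x : ℝ) :
    HasDerivAt (trigSeries d) (trigSeries (fun k => k * Complex.I * d k) x) x := by
  refine hasDerivAt_tsum (g := fun k (y : ℝ) => (d k * Complex.exp (k * y * Complex.I)).re)
    (g' := fun k (y : ℝ) => (k * Complex.I * d k * Complex.exp (k * y * Complex.I)).re) (y₀ := 0)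
    hd.index_mul.summable_norm (fun k y => ?_) (fun k y => norm_re_mul_exp_le _ k y)
    (hd.summable 0) x
  have h : HasDerivAt (fun z : ℂ => d k * Complex.exp (k * z * Complex.I))
      (k * Complex.I * d k * Complex.exp (k * y * Complex.I)) (y : ℂ) := by
    have h1 : HasDerivAt (fun z : ℂ => k * z * Complex.I) (k * Complex.I) (y : ℂ) := by
      simpa using ((hasDerivAt_id (y : ℂ)).const_mul (k : ℂ)).mul_const Complex.I
    exact (h1.cexp.const_mul (d k)).congr_deriv (by ring)
  exact h.real_of_complex

theorem trigSeries_periodic (d : ℕ → ℂ) : Function.Periodic (trigSeries d) (2 * π) := by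
  intro x
  refine tsum_congr fun k => ?_
  have : (k : ℂ) * ((x + 2 * π : ℝ) : ℂ) * Complex.I =
      k * x * Complex.I + k * (2 * π * Complex.I) := by push_cast; ring
  rw [this, Complex.exp_add, Complex.exp_nat_mul_two_pi_mul_I, mul_one]

theorem trigSeries_ofReal_mul (r : ℝ) (d : ℕ → ℂ) (x : ℝ) :
    trigSeries (fun k => r * d k) x = r * trigSeries d x := by
  simp only [trigSeries, mul_assoc, Complex.re_ofReal_mul, tsum_mul_left]

theorem HasCyclicZeros.of_interlaced {g : ℝ → ℝ} {k : ℕ} (hk : 0 < k) {y : ℕ → ℝ}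
    (hy : y k = y 0 + 2 * π)
    (h : ∀ i < k, ∃ w ∈ Ioo (y i) (y (i + 1)), g w = 0) : HasCyclicZeros g k := by
  choose! w hw hg using h
  refine ⟨fun i => if i < k then w i else w 0 + 2 * π, fun i hi => ?_, by simp [hk], fun i hi => ?_⟩
  · by_cases h1 : i + 1 < k
    · simp only [hi, h1, if_true]
      exact (hw i hi).2.trans (hw (i + 1) h1).1
    · have hik : i + 1 = k := by omega
      have h2 := (hw i hi).2
      have h0 := (hw 0 hk).1
      simp only [hi, h1, if_true, if_false]
      rw [hik] at h2
      linarith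
  · simpa [hi] using hg i hi

/-- Rolle's theorem on the circle for the operator `g ↦ g' + lam * g`. -/
theorem HasCyclicZeros.deriv_add {g g' : ℝ → ℝ} {k : ℕ} (hk : 0 < k) (lam : ℝ)
    (hg : ∀ x, HasDerivAt g (g' x) x) (hper : Function.Periodic g (2 * π))
    (h : HasCyclicZeros g k) :
    HasCyclicZeros (fun x => g' x + lam * g x) k := by
  obtain ⟨z, hz, hzk, hgz⟩ := h
  have hgz' : ∀ i ≤ k, g (z i) = 0 := by
    intro i hi
    rcases hi.lt_or_eq with hi | rfl
    · exact hgz i hi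
    · rw [hzk, hper, hgz 0 hk]
  refine of_interlaced hk hzk fun i hi => ?_
  have hd : ∀ x, HasDerivAt (fun t => exp (lam * t) * g t)
      (exp (lam * x) * (g' x + lam * g x)) x := by
    intro x
    have h1 : HasDerivAt (fun t => lam * t) lam x := by
      simpa using (hasDerivAt_id x).const_mul lam
    exact (h1.exp.mul (hg x)).congr_deriv (by ring)
  obtain ⟨w, hw, hw0⟩ := exists_hasDerivAt_eq_zero (hz i hi)
    (fun x _ => (hd x).continuousAt.continuousWithinAt)
    (by simp [hgz i hi, hgz' (i + 1) hi]) (fun x _ => hd x)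
  exact ⟨w, hw, (mul_eq_zero.1 hw0).resolve_left (exp_pos _).ne'⟩

theorem HasCyclicZeros.le_of_encard_le {g : ℝ → ℝ} {k N : ℕ}
    (hper : Function.Periodic g (2 * π))
    (hN : {x ∈ Ico (0 : ℝ) (2 * π) | g x = 0}.encard ≤ (N : ℕ∞))
    (h : HasCyclicZeros g k) : k ≤ N := by
  obtain ⟨z, hz, hzk, hgz⟩ := h
  have hmono : StrictMonoOn z (Iic k) :=
    strictMonoOn_Iic_of_lt_succ fun i hi => by simpa using hz i hi
  have hinj : InjOn (fun i => toIcoMod two_pi_pos 0 (z i)) (Finset.range k : Set ℕ) := by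
    have key : ∀ i j, i < j → j < k →
        toIcoMod two_pi_pos 0 (z i) ≠ toIcoMod two_pi_pos 0 (z j) := by
      intro i j hij hj heq
      obtain ⟨n, hn⟩ := (toIcoMod_eq_toIcoMod two_pi_pos).1 heq
      have h1 : z i < z j := hmono (by simp; omega) (by simp; omega) hij
      have h2 : z j < z k := hmono (by simp; omega) (by simp) hj
      have h3 : z 0 ≤ z i := hmono.monotoneOn (by simp) (by simp; omega) (by omega)
      rw [zsmul_eq_mul] at hn
      have hpi := two_pi_pos
      have hn0 : (0 : ℝ) < n := by
        by_contra hc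
        nlinarith
      have hn1 : (n : ℝ) < 1 := by
        by_contra hc
        nlinarith
      norm_cast at hn0 hn1
      omega
    intro i hi j hj heq
    simp only [Finset.coe_range, mem_Iio] at hi hj
    by_contra hne
    rcases lt_or_gt_of_ne hne with hlt | hlt
    · exact key i j hlt hj heq
    · exact key j i hlt hi heq.symm
  have hsub : (fun i => toIcoMod two_pi_pos 0 (z i)) '' (Finset.range k : Set ℕ) ⊆
      {x ∈ Ico (0 : ℝ) (2 * π) | g x = 0} := by
    rintro _ ⟨i, hi, rfl⟩
    refine ⟨by simpa using toIcoMod_mem_Ico two_pi_pos 0 (z i), ?_⟩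
    simp only [toIcoMod]
    rw [hper.sub_zsmul_eq]
    exact hgz i (by simpa using hi)
  have := (encard_le_encard hsub).trans hN
  rw [hinj.encard_image, encard_coe_eq_coe_finsetCard, Finset.card_range] at this
  exact_mod_cast this

theorem RapidDecay.hasCyclicZeros_mul {d : ℕ → ℂ} (hd : RapidDecay d) {k : ℕ} (hk : 0 < k)
    (lam : ℝ) (h : HasCyclicZeros (trigSeries d) k) :
    HasCyclicZeros (trigSeries fun j => (j * Complex.I + lam) * d j) k := by
  have := h.deriv_add hk lam hd.hasDerivAt (trigSeries_periodic _)
  convert this using 2 with x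
  rw [← trigSeries_ofReal_mul, trigSeries, trigSeries, trigSeries,
    ← (hd.index_mul.summable x).tsum_add]
  · refine tsum_congr fun j => ?_
    rw [← Complex.add_re]
    ring_nf
  · exact (hd.of_norm_le (e := fun k => lam * d k) (A := |lam|) (B := 0)
      fun k => by simp).summable x

theorem RapidDecay.mul_add {d : ℕ → ℂ} (hd : RapidDecay d) (lam : ℝ) :
    RapidDecay fun j => (j * Complex.I + lam) * d j :=
  hd.of_norm_le (A := |lam|) (B := 1) fun k => by
    rw [norm_mul]
    gcongr
    refine (norm_add_le _ _).trans ?_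
    simp [add_comm]

theorem RapidDecay.hasCyclicZeros_mul_pow {d : ℕ → ℂ} (hd : RapidDecay d) {k : ℕ} (hk : 0 < k)
    (lam : ℝ) (m : ℕ) (h : HasCyclicZeros (trigSeries d) k) :
    HasCyclicZeros (trigSeries fun j => (-((j : ℂ) ^ 2 + lam ^ 2)) ^ m * d j) k := by
  induction m generalizing d with
  | zero => simpa using h
  | succ m ih =>
    have := ih (hd.mul_add (-lam) |>.mul_add lam)
      ((hd.mul_add (-lam)).hasCyclicZeros_mul hk lam (hd.hasCyclicZeros_mul hk (-lam) h))
    convert this using 3 with j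
    have e : (-((j : ℂ) ^ 2 + lam ^ 2)) =
        (j * Complex.I + lam) * (j * Complex.I + (-lam : ℝ)) := by
      push_cast
      linear_combination (-(j : ℂ) ^ 2) * Complex.I_sq
    rw [pow_succ, mul_assoc, ← mul_assoc (_ + _) (_ + _), ← e]

theorem RapidDecay.iteratedDeriv_trigSeries {d : ℕ → ℂ} (hd : RapidDecay d) (m : ℕ) :
    iteratedDeriv m (trigSeries d) = trigSeries fun k => (k * Complex.I) ^ m * d k := by
  induction m generalizing d with
  | zero => simp
  | succ m ih =>
    rw [iteratedDeriv_succ', show deriv (trigSeries d) = _ from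
      funext fun x => (hd.hasDerivAt x).deriv, ih hd.index_mul]
    simp only [pow_succ, mul_assoc]

theorem exists_mem_Ioo_eq_zero {g : ℝ → ℝ} (hg : Continuous g) {a b : ℝ} (hab : a < b)
    (h : g a * g b < 0) : ∃ w ∈ Ioo a b, g w = 0 := by
  have h0 : (0 : ℝ) ∈ uIcc (g a) (g b) := by
    rw [mem_uIcc]
    rcases mul_neg_iff.1 h with h | h
    · exact Or.inr ⟨h.2.le, h.1.le⟩
    · exact Or.inl ⟨h.1.le, h.2.le⟩
  obtain ⟨w, hw, hw0⟩ := intermediate_value_uIcc (hg.continuousOn (s := uIcc a b)) h0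
  rw [uIcc_of_le hab.le] at hw
  refine ⟨w, ⟨lt_of_le_of_ne hw.1 ?_, lt_of_le_of_ne hw.2 ?_⟩, hw0⟩
  · rintro rfl
    simp [hw0] at h
  · rintro rfl
    simp [hw0] at h

/-- A Fourier multiplier that equals `1` at frequency `n` and is smaller elsewhere. -/
noncomputable def peakMultiplier (n k : ℕ) : ℝ := 2 * n * k / (k ^ 2 + n ^ 2)

theorem peakMultiplier_nonneg (n k : ℕ) : 0 ≤ peakMultiplier n k := by
  unfold peakMultiplier
  positivity

theorem peakMultiplier_le_one (n k : ℕ) : peakMultiplier n k ≤ 1 :=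
  div_le_one_of_le₀ (by nlinarith [sq_nonneg ((k : ℝ) - n)]) (by positivity)

theorem peakMultiplier_self {n : ℕ} (hn : 0 < n) : peakMultiplier n n = 1 := by
  have : (0 : ℝ) < n := by exact_mod_cast hn
  unfold peakMultiplier
  field_simp
  norm_num

theorem peakMultiplier_lt_one {n k : ℕ} (hn : 0 < n) (hk : k ≠ n) : peakMultiplier n k < 1 := by
  have hn' : (0 : ℝ) < n := by exact_mod_cast hn
  have hk' : (k : ℝ) - n ≠ 0 := sub_ne_zero.2 (by exact_mod_cast hk)
  unfold peakMultiplier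
  rw [div_lt_one (by positivity)]
  nlinarith [sq_pos_of_ne_zero hk']

theorem RapidDecay.peakMultiplier_pow_mul {d : ℕ → ℂ} (hd : RapidDecay d) (n p : ℕ) :
    RapidDecay fun k => (peakMultiplier n k : ℂ) ^ p * d k :=
  hd.of_norm_le (A := 1) (B := 0) fun k => by
    rw [norm_mul, norm_pow, Complex.norm_real, Real.norm_of_nonneg (peakMultiplier_nonneg n k),
      zero_mul, add_zero]
    gcongr
    exact pow_le_one₀ (peakMultiplier_nonneg n k) (peakMultiplier_le_one n k)

theorem RapidDecay.tendsto_peakMultiplier {d : ℕ → ℂ} (hd : RapidDecay d) {n : ℕ} (hn : 0 < n)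
    (x : ℝ) :
    Tendsto (fun m : ℕ => trigSeries (fun k => (peakMultiplier n k : ℂ) ^ (4 * m) * d k) x) atTop
      (𝓝 (d n * Complex.exp (n * x * Complex.I)).re) := by
  let term : ℕ → ℝ := fun k => (d k * Complex.exp (k * x * Complex.I)).re
  have hsum : ∑' k, (if k = n then term k else 0) = term n := by
    rw [tsum_eq_single n fun k hk => if_neg hk, if_pos rfl]
  have hterm (m k : ℕ) : ((peakMultiplier n k : ℂ) ^ (4 * m) * d k *
      Complex.exp (k * x * Complex.I)).re = peakMultiplier n k ^ (4 * m) * term k := by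
    rw [← Complex.ofReal_pow, mul_assoc, Complex.re_ofReal_mul]
  change Tendsto _ _ (𝓝 (term n))
  rw [← hsum]
  simp only [trigSeries, hterm]
  refine tendsto_tsum_of_dominated_convergence hd.summable_norm (fun k => ?_)
    (.of_forall fun m k => ?_)
  · by_cases hk : k = n
    · subst hk
      simp [peakMultiplier_self hn]
    · have hpow := tendsto_pow_atTop_nhds_zero_of_lt_one (peakMultiplier_nonneg n k)
        (peakMultiplier_lt_one hn hk)
      have h4 : Tendsto (fun m : ℕ => 4 * m) atTop atTop :=
        tendsto_id.const_mul_atTop' (by norm_num)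
      simpa [hk] using (hpow.comp h4).mul_const (term k)
  · rw [norm_mul, norm_pow, Real.norm_of_nonneg (peakMultiplier_nonneg n k)]
    refine (mul_le_of_le_one_left (norm_nonneg _) (pow_le_one₀ (peakMultiplier_nonneg n k)
      (peakMultiplier_le_one n k))).trans (norm_re_mul_exp_le _ k x)

theorem re_mul_exp_extremum (z : ℂ) {n : ℕ} (hn : 0 < n) (i : ℕ) :
    (z * Complex.exp (n * ((i * π - z.arg) / n : ℝ) * Complex.I)).re = (-1) ^ i * ‖z‖ := by
  have hn' : (n : ℂ) ≠ 0 := by exact_mod_cast hn.ne'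
  have h : (n : ℂ) * ((i * π - z.arg) / n : ℝ) * Complex.I =
      i * (π * Complex.I) - z.arg * Complex.I := by
    push_cast
    field_simp
  have hz : z * Complex.exp (n * ((i * π - z.arg) / n : ℝ) * Complex.I) =
      (((-1) ^ i * ‖z‖ : ℝ) : ℂ) := by
    rw [h, Complex.exp_sub, Complex.exp_nat_mul, Complex.exp_pi_mul_I]
    nth_rw 1 [← Complex.norm_mul_exp_arg_mul_I z]
    field_simp
    push_cast
    ring
  rw [hz, Complex.ofReal_re]

theorem RapidDecay.exists_hasCyclicZeros {d : ℕ → ℂ} (hd : RapidDecay d) {n : ℕ} (hn : 0 < n)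
    (hdn : d n ≠ 0) :
    ∃ m : ℕ, HasCyclicZeros (trigSeries fun k => (peakMultiplier n k : ℂ) ^ (4 * m) * d k)
      (2 * n) := by
  let y : ℕ → ℝ := fun i => (i * π - (d n).arg) / n
  have hn' : (0 : ℝ) < n := by exact_mod_cast hn
  have hsign : ∀ᶠ m : ℕ in atTop, ∀ i ∈ Finset.range (2 * n + 1),
      0 < (-1) ^ i * trigSeries (fun k => (peakMultiplier n k : ℂ) ^ (4 * m) * d k) (y i) := by
    rw [eventually_all_finset]
    intro i _
    have h := (hd.tendsto_peakMultiplier hn (y i)).const_mul ((-1) ^ i)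
    rw [re_mul_exp_extremum, ← mul_assoc, ← mul_pow] at h
    · exact h.eventually_const_lt (by simpa using hdn)
    · exact hn
  obtain ⟨m, hm⟩ := hsign.exists
  have hrd := hd.peakMultiplier_pow_mul n (4 * m)
  refine ⟨m, .of_interlaced (y := y) (by omega) ?_ fun i hi => ?_⟩
  · simp only [y]
    push_cast
    field_simp
    ring
  · refine exists_mem_Ioo_eq_zero
      (continuous_iff_continuousAt.2 fun x => (hrd.hasDerivAt x).continuousAt) ?_ ?_
    · simp only [y]
      push_cast
      gcongr
      linarith
    · have h := mul_pos (hm i (by simp; omega)) (hm (i + 1) (by simp; omega))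
      have hs : ((-1 : ℝ) ^ i) * (-1) ^ i = 1 := by rw [← mul_pow]; simp
      rw [pow_succ] at h
      linear_combination h - (trigSeries (fun k => (peakMultiplier n k : ℂ) ^ (4 * m) * d k) (y i) *
        trigSeries (fun k => (peakMultiplier n k : ℂ) ^ (4 * m) * d k) (y (i + 1))) * hs

theorem RapidDecay.eq_zero_of_encard_le {d : ℕ → ℂ} (hd : RapidDecay d) {N : ℕ}
    (hN : ∀ i : ℕ, {x ∈ Ico (0 : ℝ) (2 * π) | iteratedDeriv i (trigSeries d) x = 0}.encard ≤
      (N : ℕ∞)) {n : ℕ} (hn : N < 2 * n) : d n = 0 := by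
  by_contra hdn
  have hn0 : 0 < n := by omega
  obtain ⟨m, hm⟩ := hd.exists_hasCyclicZeros hn0 hdn
  have hrd := hd.peakMultiplier_pow_mul n (4 * m)
  have hzeros := hrd.hasCyclicZeros_mul_pow (by omega) n (4 * m) hm
  have hcoeff : (fun k : ℕ => (-((k : ℂ) ^ 2 + (n : ℝ) ^ 2)) ^ (4 * m) *
      ((peakMultiplier n k : ℂ) ^ (4 * m) * d k)) =
      fun k : ℕ => (((2 * n) ^ (4 * m) : ℝ) : ℂ) * ((k * Complex.I) ^ (4 * m) * d k) := by
    funext k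
    have hne : (k : ℂ) ^ 2 + (n : ℂ) ^ 2 ≠ 0 := by
      norm_cast
      positivity
    have hq : (-((k : ℂ) ^ 2 + (n : ℝ) ^ 2)) * peakMultiplier n k = -(2 * n * k) := by
      unfold peakMultiplier
      push_cast
      field_simp
    rw [← mul_assoc, ← mul_pow, hq, (even_iff_two_dvd.2 ⟨2 * m, by ring⟩ : Even (4 * m)).neg_pow,
      mul_pow _ Complex.I, pow_mul Complex.I, Complex.I_pow_four, one_pow, mul_pow]
    push_cast
    ring
  obtain ⟨z, hz, hzk, hgz⟩ := hcoeff ▸ hzeros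
  have hD := hd.iteratedDeriv_trigSeries (4 * m)
  have hpos : (0 : ℝ) < (2 * n) ^ (4 * m) := by positivity
  have hD0 : HasCyclicZeros (iteratedDeriv (4 * m) (trigSeries d)) (2 * n) :=
    ⟨z, hz, hzk, fun i hi => by
      have := hgz i hi
      rw [trigSeries_ofReal_mul] at this
      rw [hD]
      exact (mul_eq_zero.1 this).resolve_left hpos.ne'⟩
  have := hD0.le_of_encard_le (hD ▸ trigSeries_periodic _) (hN (4 * m))
  omega

theorem exists_norm_fourierCoeffOn_le (j : ℕ) {f : ℝ → ℝ} (hf : ContDiff ℝ (⊤ : ℕ∞) f)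
    (hper : Function.Periodic f (2 * π)) :
    ∃ M : ℝ, ∀ n : ℤ,
      |(n : ℝ)| ^ j * ‖fourierCoeffOn two_pi_pos (fun x => (f x : ℂ)) n‖ ≤ M := by
  induction j generalizing f with
  | zero =>
    obtain ⟨C, hC⟩ := (isCompact_Icc (a := (0 : ℝ)) (b := 2 * π)).exists_bound_of_continuousOn
      hf.continuous.continuousOn
    refine ⟨C, fun n => ?_⟩
    rw [pow_zero, one_mul, fourierCoeffOn_eq_integral, norm_smul]
    have h := intervalIntegral.norm_integral_le_of_norm_le_const (a := 0) (b := 2 * π) (C := C)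
      (f := fun x => fourier (-n) (x : AddCircle (2 * π - 0)) • (f x : ℂ)) fun x hx => by
        rw [uIoc_of_le two_pi_pos.le] at hx
        rw [norm_smul, fourier_apply, Circle.norm_coe, one_mul, Complex.norm_real]
        exact hC x ⟨hx.1.le, hx.2⟩
    have hpi := two_pi_pos
    rw [sub_zero, abs_of_pos hpi] at h
    rw [sub_zero, Real.norm_of_nonneg (by positivity), one_div, inv_mul_le_iff₀ hpi, mul_comm (2 * π) C]
    simpa only [sub_zero] using h
  | succ j ih =>
    have hf' : ContDiff ℝ (⊤ : ℕ∞) (deriv f) := (contDiff_infty_iff_deriv.1 hf).2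
    have hper' : Function.Periodic (deriv f) (2 * π) := fun x => by
      rw [← deriv_comp_add_const, show (fun x => f (x + 2 * π)) = f from funext hper]
    obtain ⟨M, hM⟩ := ih hf' hper'
    refine ⟨M, fun n => ?_⟩
    rcases eq_or_ne n 0 with rfl | hn
    · have := (hM 0).trans' (by positivity : (0 : ℝ) ≤ _)
      simpa using this
    · have hn' : (n : ℝ) ≠ 0 := by exact_mod_cast hn
      have h := fourierCoeffOn_of_hasDerivAt two_pi_pos (f := fun x => (f x : ℂ))
        (f' := fun x => ((deriv f x : ℝ) : ℂ)) hn
        (fun x _ => ((hf.differentiable (by simp) x).hasDerivAt).ofReal_comp)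
        ((Complex.continuous_ofReal.comp hf'.continuous).intervalIntegrable _ _)
      have h0 : f (2 * π) = f 0 := by simpa using hper 0
      refine le_trans (le_of_eq ?_) (hM n)
      rw [h, h0, sub_self, mul_zero, zero_sub, norm_mul, norm_neg, norm_mul]
      simp [abs_of_pos pi_pos]
      field_simp
      ring

theorem exists_rapidDecay_eq_trigSeries {f : ℝ → ℝ} (hf : ContDiff ℝ (⊤ : ℕ∞) f)
    (hper : Function.Periodic f (2 * π)) :
    ∃ d : ℕ → ℂ, RapidDecay d ∧ f = trigSeries d := by
  have : Fact (0 < 2 * π) := ⟨two_pi_pos⟩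
  have hperC : Function.Periodic (fun x => (f x : ℂ)) (2 * π) := fun x => by simp only [hper x]
  let F : C(AddCircle (2 * π), ℂ) :=
    ⟨hperC.lift, continuous_coinduced_dom.mpr (Complex.continuous_ofReal.comp hf.continuous)⟩
  have hF : ∀ x : ℝ, F (x : AddCircle (2 * π)) = f x := fun x => hperC.lift_coe x
  have hbound : ∀ j : ℕ, ∃ M : ℝ, ∀ n : ℤ, |(n : ℝ)| ^ j * ‖fourierCoeff F n‖ ≤ M := by
    intro j
    obtain ⟨M, hM⟩ := exists_norm_fourierCoeffOn_le j hf hper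
    refine ⟨M, fun n => ?_⟩
    convert hM n using 3
    rw [fourierCoeffOn_eq_integral, fourierCoeff_eq_intervalIntegral _ _ 0]
    simp only [fourier_coe_apply, hF, zero_add, sub_zero]
  have hdecay : ∀ j : ℕ, Summable fun n : ℤ => |(n : ℝ)| ^ j * ‖fourierCoeff F n‖ := by
    intro j
    obtain ⟨M, hM⟩ := hbound (j + 2)
    have hs : Summable fun n : ℤ => M * (1 / (n : ℝ) ^ 2) :=
      (Real.summable_one_div_int_pow.2 one_lt_two).mul_left M
    refine Summable.of_norm_bounded_eventually hs ?_
    filter_upwards [(finite_singleton (0 : ℤ)).compl_mem_cofinite] with n hn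
    have hn' : (n : ℝ) ≠ 0 := by exact_mod_cast hn
    rw [Real.norm_of_nonneg (by positivity), mul_one_div, le_div_iff₀ (by positivity)]
    refine le_trans (le_of_eq ?_) (hM n)
    rw [pow_add, sq_abs]
    ring
  have hsum : ∀ x : ℝ, HasSum (fun n : ℤ => (fourierCoeff F n *
      Complex.exp (n * x * Complex.I)).re) (f x) := by
    intro x
    have h := has_pointwise_sum_fourier_series_of_summable (f := F)
      (.of_norm (by simpa using hdecay 0)) (x : AddCircle (2 * π))
    rw [hF] at h
    convert Complex.hasSum_re h using 3 with n
    · rw [smul_eq_mul, fourier_coe_apply]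
      congr 2
      have : (π : ℂ) ≠ 0 := by exact_mod_cast pi_ne_zero
      push_cast
      field_simp
    · exact (Complex.ofReal_re _).symm
  let d : ℕ → ℂ := fun k =>
    if k = 0 then fourierCoeff F 0
    else fourierCoeff F k + (starRingEnd ℂ) (fourierCoeff F (-k))
  refine ⟨d, fun j => ?_, funext fun x => ?_⟩
  · have h1 := (hdecay j).comp_injective Nat.cast_injective
    have h2 := (hdecay j).comp_injective (neg_injective.comp Nat.cast_injective)
    refine Summable.of_nonneg_of_le (fun k => by positivity) (fun k => ?_) (h1.add h2)
    simp only [Function.comp_apply, Int.cast_neg, Int.cast_natCast, abs_neg, Nat.abs_cast,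
      ← mul_add]
    gcongr
    simp only [d]
    split_ifs with hk
    · simp [hk]
    · exact (norm_add_le _ _).trans (by rw [Complex.norm_conj])
  · have h := (hsum x).nat_add_neg
    have h0 : HasSum (fun k : ℕ => if k = 0 then (fourierCoeff F 0).re else 0)
        (fourierCoeff F 0).re := hasSum_ite_eq 0 _
    have h' := h.sub h0
    simp only [Int.cast_zero, zero_mul, Complex.exp_zero, mul_one, add_sub_cancel_right] at h'
    rw [← h'.tsum_eq]
    refine tsum_congr fun k => ?_
    simp only [d]
    split_ifs with hk
    · simp [hk]
    · have hconj : ((starRingEnd ℂ) (fourierCoeff F (-k)) * Complex.exp (k * x * Complex.I)).re =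
          (fourierCoeff F (-k) * Complex.exp ((-k : ℤ) * x * Complex.I)).re := by
        rw [← Complex.conj_re, map_mul, Complex.conj_conj, ← Complex.exp_conj]
        simp
      rw [add_mul, Complex.add_re, hconj]
      simp

theorem re_mul_exp_eq (z : ℂ) (k : ℕ) (x : ℝ) :
    (z * Complex.exp (k * x * Complex.I)).re =
      z.re * Real.cos (k * x) + -z.im * Real.sin (k * x) := by
  have h : (k : ℂ) * x = ((k * x : ℝ) : ℂ) := by push_cast; rfl
  rw [h, Complex.mul_re, Complex.exp_ofReal_mul_I_re, Complex.exp_ofReal_mul_I_im]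
  ring

/-- **Pólya–Wiener theorem.** If `f` is a smooth `2π`-periodic function such
that the number of zeros of `f⁽ⁱ⁾` in `[0, 2π)` is bounded uniformly in `i`,
then `f` is a trigonometric polynomial. -/
theorem polya_wiener
    (f : ℝ → ℝ) (hf : ContDiff ℝ (⊤ : ℕ∞) f)
    (hper : Function.Periodic f (2 * π))
    (N : ℕ)
    (hbound : ∀ i : ℕ,
      {x ∈ Set.Ico (0 : ℝ) (2 * π) | iteratedDeriv i f x = 0}.encard ≤ (N : ℕ∞)) :
    ∃ (n : ℕ) (a b : ℕ → ℝ), ∀ x : ℝ,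
      f x = a 0 + ∑ k ∈ Finset.Icc 1 n, (a k * Real.cos (k * x) + b k * Real.sin (k * x)) := by
  obtain ⟨d, hd, rfl⟩ := exists_rapidDecay_eq_trigSeries hf hper
  refine ⟨N, fun k => (d k).re, fun k => -(d k).im, fun x => ?_⟩
  rw [trigSeries, tsum_eq_sum (s := Finset.range (N + 1)), Finset.sum_range_succ',
    Finset.range_eq_Ico, Finset.sum_Ico_add' (fun k : ℕ => (d k *
      Complex.exp (k * x * Complex.I)).re) 0 N 1]
  · simp only [re_mul_exp_eq]
    simp [add_comm, Finset.Ico_add_one_right_eq_Icc]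
  · intro k hk
    have hk' : N < 2 * k := by
      rw [Finset.mem_range] at hk
      omega
    rw [hd.eq_zero_of_encard_le hbound hk', zero_mul, Complex.zero_re]
end

section
/- Let ♭ₙ denote the number of finite sequences of length C(n+1, 2) = n(n+1)/2 over the alphabet {0, 1, …, n−1} containing exactly n−i occurrences of the symbol i for each i, and such that between any two consecutive occurrences of the symbol i there is exactly one occurrence of the symbol i+1. Then ♭ₙ = (n(n+1)/2)! · (1!·2!·…·(n−1)!) / (1!·3!·…·(2n−1)!). -/
open Set

/-- A symbolic sequence for degree `n`: a word over the alphabet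
`{0, 1, …, n-1}` with exactly `n - i` occurrences of each symbol `i`
(hence of length `n(n+1)/2`), such that between any two consecutive
occurrences of the symbol `i` there is exactly one occurrence of the
symbol `i + 1`. -/
def IsSymbolicSequence (n : ℕ) (w : List ℕ) : Prop :=
  w.length = n * (n + 1) / 2 ∧
  (∀ s ∈ w, s < n) ∧
  (∀ i < n, w.count i = n - i) ∧
  ∀ (i : ℕ) (p q : Fin w.length), p < q → w.get p = i → w.get q = i →
    (∀ r : Fin w.length, p < r → r < q → w.get r ≠ i) →
    (∃! r : Fin w.length, p < r ∧ r < q ∧ w.get r = i + 1)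

open Polynomial in
/-- The divided-difference evaluation of a monic polynomial whose degree is the number of nodes. -/
theorem sum_prod_sub_div_prod_sub {ι F : Type*} [DecidableEq ι] [Field F] (s : Finset ι)
    (a b : ι → F) (ha : Set.InjOn a s) :
    ∑ i ∈ s, (∏ j ∈ s, (a i - b j)) / ∏ j ∈ s.erase i, (a i - a j) =
      ∑ i ∈ s, a i - ∑ i ∈ s, b i := by
  rcases s.eq_empty_or_nonempty with rfl | hs
  · simp
  have hdeg : (Lagrange.nodal s b - Lagrange.nodal s a).degree < s.card := by
    have h := degree_sub_lt_left (p := Lagrange.nodal s b) (q := Lagrange.nodal s a)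
      (by rw [Lagrange.degree_nodal, Lagrange.degree_nodal]) Lagrange.nodal_ne_zero
      (by rw [Lagrange.nodal_monic.leadingCoeff, Lagrange.nodal_monic.leadingCoeff])
    rwa [Lagrange.degree_nodal] at h
  have h := Lagrange.coeff_eq_sum ha hdeg
  rw [coeff_sub, Lagrange.nodal_eq, Lagrange.nodal_eq,
    prod_X_sub_C_coeff_card_pred _ _ hs.card_pos,
    prod_X_sub_C_coeff_card_pred _ _ hs.card_pos] at h
  rw [← neg_sub_neg, h]
  refine Finset.sum_congr rfl fun i hi => ?_
  rw [← Lagrange.nodal_eq, ← Lagrange.nodal_eq, eval_sub, Lagrange.eval_nodal_at_node hi,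
    Lagrange.eval_nodal, sub_zero]

theorem sum_mul_prod_shift (S : Finset ℕ) (hS : 0 ∉ S) :
    ∑ s ∈ S, (s : ℚ) * ∏ r ∈ S.erase s,
      (((s : ℚ) - 1 - r) * (s + r)) / (((s : ℚ) - 1 + r) * (s - r)) = ∑ s ∈ S, (s : ℚ) := by
  have hinj : Set.InjOn (fun s : ℕ => (s : ℚ) * (s - 1)) S := by
    intro s hs t ht hst
    have hs1 : (1 : ℚ) ≤ s := by exact_mod_cast Nat.one_le_iff_ne_zero.2 fun h => hS (h ▸ hs)
    have ht1 : (1 : ℚ) ≤ t := by exact_mod_cast Nat.one_le_iff_ne_zero.2 fun h => hS (h ▸ ht)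
    have h : ((s : ℚ) - t) * (s + t - 1) = 0 := by
      simp only at hst
      linear_combination hst
    rcases mul_eq_zero.1 h with h | h
    · exact_mod_cast sub_eq_zero.1 h
    · linarith
  have h := sum_prod_sub_div_prod_sub S _ (fun s : ℕ => (s : ℚ) * (s + 1)) hinj
  rw [← Finset.sum_sub_distrib] at h
  have hr : ∀ s ∈ S, (s : ℚ) * (s - 1) - s * (s + 1) = -2 * s := fun s _ => by ring
  rw [Finset.sum_congr rfl hr, ← Finset.mul_sum] at h
  rw [← mul_right_inj' (show (-2 : ℚ) ≠ 0 by norm_num), ← h, Finset.mul_sum]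
  refine Finset.sum_congr rfl fun s hs => ?_
  rw [← Finset.mul_prod_erase S _ hs, hr s hs, mul_div_assoc, ← Finset.prod_div_distrib, mul_assoc]
  congr 2
  refine Finset.prod_congr rfl fun r _ => ?_
  congr 1 <;> ring

/-- The reciprocal of the hook product of the shifted diagram whose row lengths are the elements
of `S`. -/
noncomputable def shiftedWeight (S : Finset ℕ) : ℚ :=
  ∏ s ∈ S, ((s.factorial : ℚ)⁻¹ * ∏ t ∈ S, if t < s then ((s : ℚ) - t) / (s + t) else 1)

theorem shiftedWeight_insert {S : Finset ℕ} {k : ℕ} (hk : k ∉ S) :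
    shiftedWeight (insert k S) =
      shiftedWeight S * ((k.factorial : ℚ)⁻¹ * ∏ r ∈ S, |(k : ℚ) - r| / (k + r)) := by
  have h : ∀ r ∈ S, |(k : ℚ) - r| / (k + r) = (if r < k then ((k : ℚ) - r) / (k + r) else 1) *
      (if k < r then ((r : ℚ) - k) / (r + k) else 1) := by
    intro r hr
    rcases lt_trichotomy r k with h | h | h
    · have h' : (r : ℚ) < k := by exact_mod_cast h
      rw [if_pos h, if_neg h.not_gt, abs_of_pos (by linarith), mul_one]
    · exact absurd (h ▸ hr) hk
    · have h' : (k : ℚ) < r := by exact_mod_cast h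
      rw [if_neg h.not_gt, if_pos h, abs_of_neg (by linarith), one_mul, neg_sub, add_comm]
  rw [Finset.prod_congr rfl h, shiftedWeight, shiftedWeight, Finset.prod_insert hk,
    Finset.prod_insert hk]
  simp only [Finset.prod_insert hk, lt_irrefl, if_false, one_mul, Finset.prod_mul_distrib]
  ring

theorem shiftedWeight_insert_zero {S : Finset ℕ} (hS : 0 ∉ S) :
    shiftedWeight (insert 0 S) = shiftedWeight S := by
  rw [shiftedWeight_insert hS, Finset.prod_eq_one]
  · simp
  · intro r hr
    have : (r : ℚ) ≠ 0 := Nat.cast_ne_zero.2 fun h => hS (h ▸ hr)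
    simp [this]

theorem shiftedWeight_move {S : Finset ℕ} {k : ℕ} (hS : 0 ∉ S) (hk : k + 1 ∈ S) (hk' : k ∉ S) :
    shiftedWeight (insert k (S.erase (k + 1))) = shiftedWeight S * (((k + 1 : ℕ) : ℚ) *
      ∏ r ∈ S.erase (k + 1), ((((k + 1 : ℕ) : ℚ) - 1 - r) * ((k + 1 : ℕ) + r)) /
        ((((k + 1 : ℕ) : ℚ) - 1 + r) * ((k + 1 : ℕ) - r))) := by
  have h1 : k ∉ S.erase (k + 1) := fun h => hk' (Finset.mem_of_mem_erase h)
  conv_rhs => rw [← Finset.insert_erase hk, Finset.erase_insert (Finset.notMem_erase _ _)]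
  rw [shiftedWeight_insert h1, shiftedWeight_insert (Finset.notMem_erase _ _), Nat.factorial_succ]
  have h2 : ∀ r ∈ S.erase (k + 1), |(k : ℚ) - r| / (k + r) =
      |((k + 1 : ℕ) : ℚ) - r| / ((k + 1 : ℕ) + r) *
        (((((k + 1 : ℕ) : ℚ) - 1 - r) * ((k + 1 : ℕ) + r)) /
        ((((k + 1 : ℕ) : ℚ) - 1 + r) * ((k + 1 : ℕ) - r))) := by
    intro r hr
    obtain ⟨hr1, hr2⟩ := Finset.mem_erase.1 hr
    have hr0 : (0 : ℚ) < r := by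
      exact_mod_cast Nat.pos_of_ne_zero fun h => hS (h ▸ hr2)
    have hk0 : (0 : ℚ) ≤ k := k.cast_nonneg
    have hkr : r ≠ k := fun h => hk' (h ▸ hr2)
    push_cast
    rw [add_sub_cancel_right]
    have e1 : (k : ℚ) + r ≠ 0 := by positivity
    have e2 : (k : ℚ) + 1 + r ≠ 0 := by positivity
    rcases lt_or_gt_of_ne hkr with h | h
    · have h' : (r : ℚ) < k := by exact_mod_cast h
      rw [abs_of_pos (by linarith), abs_of_pos (by linarith)]
      have e3 : (k : ℚ) + 1 - r ≠ 0 := by linarith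
      field_simp
    · have h' : (k : ℚ) + 1 < r := by
        exact_mod_cast (show k + 1 < r by omega)
      rw [abs_of_neg (by linarith), abs_of_neg (by linarith)]
      have e3 : (k : ℚ) + 1 - r ≠ 0 := by linarith
      field_simp
  rw [Finset.prod_congr rfl h2, Finset.prod_mul_distrib]
  have : (k.factorial : ℚ) ≠ 0 := by exact_mod_cast k.factorial_ne_zero
  push_cast
  field_simp

theorem sum_shiftedWeight_move {S : Finset ℕ} (hS : 0 ∉ S) :
    ∑ s ∈ S with s - 1 ∉ S, shiftedWeight (insert (s - 1) (S.erase s)) =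
      shiftedWeight S * ∑ s ∈ S, (s : ℚ) := by
  rw [← sum_mul_prod_shift S hS, Finset.mul_sum, Finset.sum_filter]
  refine Finset.sum_congr rfl fun s hs => ?_
  obtain ⟨k, rfl⟩ : ∃ k, s = k + 1 := Nat.exists_eq_succ_of_ne_zero fun h => hS (h ▸ hs)
  rw [Nat.add_sub_cancel]
  split_ifs with h
  · rw [Finset.prod_eq_zero (i := k)]
    · simp
    · simpa using h
    · simp
  · exact shiftedWeight_move hS hs h

theorem prod_Icc_add_mul_factorial (a m : ℕ) :
    (∏ r ∈ Finset.Icc 1 m, ((a : ℚ) + r)) * a.factorial = (a + m).factorial := by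
  induction m with
  | zero => simp
  | succ m ih =>
    rw [Finset.prod_Icc_succ_top (by omega), mul_right_comm, ih, ← add_assoc, Nat.factorial_succ]
    push_cast
    ring

theorem prod_Icc_abs_sub (n : ℕ) :
    ∏ r ∈ Finset.Icc 1 n, |((n + 1 : ℕ) : ℚ) - r| = n.factorial := by
  rw [← Finset.prod_range_add_one_eq_factorial, Nat.cast_prod]
  refine Finset.prod_nbij' (fun r => n - r) (fun i => n - i) ?_ ?_ ?_ ?_ ?_
  · intro r hr
    simp at hr ⊢
    omega
  · intro r hr
    simp at hr ⊢
    omega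
  · intro r hr
    simp at hr ⊢
    omega
  · intro r hr
    simp at hr ⊢
    omega
  · intro r hr
    have hr' := (Finset.mem_Icc.1 hr).2
    have : (r : ℚ) ≤ n := by exact_mod_cast hr'
    push_cast [hr']
    rw [abs_of_pos (by linarith)]
    ring

theorem shiftedWeight_Icc (n : ℕ) :
    shiftedWeight (Finset.Icc 1 n) = (∏ k ∈ Finset.range n, (k.factorial : ℚ)) /
      ∏ k ∈ Finset.range n, ((2 * k + 1).factorial : ℚ) := by
  induction n with
  | zero => simp [shiftedWeight]
  | succ n ih =>
    have h : Finset.Icc 1 (n + 1) = insert (n + 1) (Finset.Icc 1 n) := by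
      ext; simp; omega
    rw [h, shiftedWeight_insert (by simp), ih, Finset.prod_range_succ, Finset.prod_range_succ,
      mul_div_mul_comm]
    congr 1
    have hden := prod_Icc_add_mul_factorial (n + 1) n
    rw [show n + 1 + n = 2 * n + 1 by ring] at hden
    rw [Finset.prod_div_distrib, prod_Icc_abs_sub, ← hden, inv_mul_eq_div, div_div]

/-- The number of elements of `S` exceeding `i`: the length of the `i`-th diagonal of the shifted
diagram whose row lengths are the elements of `S`. -/
def diagLength (S : Finset ℕ) (i : ℕ) : ℕ := (S.filter (i < ·)).card

/-- Consecutive symbols occur in `w` equally often, or the smaller one occurs once more. -/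
def IsBalanced (w : List ℕ) : Prop :=
  ∀ i, w.count (i + 1) ≤ w.count i ∧ w.count i ≤ w.count (i + 1) + 1

/-- The reversed words with balanced prefixes whose symbol counts are the diagonal lengths of the
shifted diagram with row lengths `S`. -/
def balancedWords (S : Finset ℕ) : Set (List ℕ) :=
  {w | (∀ i, w.count i = diagLength S i) ∧ ∀ u, u <:+ w → IsBalanced u}

theorem diagLength_insert {S : Finset ℕ} {k : ℕ} (hk : k ∉ S) (i : ℕ) :
    diagLength (insert k S) i = diagLength S i + if i < k then 1 else 0 := by
  unfold diagLength
  rw [Finset.filter_insert]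
  split_ifs with h
  · rw [Finset.card_insert_of_notMem (by simp [hk])]
  · simp

theorem diagLength_erase_zero (S : Finset ℕ) (i : ℕ) :
    diagLength (S.erase 0) i = diagLength S i := by
  by_cases h : 0 ∈ S
  · conv_rhs => rw [← Finset.insert_erase h, diagLength_insert (Finset.notMem_erase _ _)]
    simp
  · rw [Finset.erase_eq_of_notMem h]

theorem diagLength_eq_succ (S : Finset ℕ) (i : ℕ) :
    diagLength S i = diagLength S (i + 1) + if i + 1 ∈ S then 1 else 0 := by
  induction S using Finset.induction_on with
  | empty => simp [diagLength]
  | insert k S hk ih =>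
    rw [diagLength_insert hk, diagLength_insert hk, ih]
    by_cases h : i + 1 = k
    · subst h
      simp [hk]
    · simp only [Finset.mem_insert, h, false_or]
      split_ifs <;> omega

theorem diagLength_move {S : Finset ℕ} {k : ℕ} (hk : k + 1 ∈ S) (hk' : k ∉ S) (i : ℕ) :
    diagLength S i =
      diagLength (insert k (S.erase (k + 1))) i + if k = i then 1 else 0 := by
  have h1 : k ∉ S.erase (k + 1) := fun h => hk' (Finset.mem_of_mem_erase h)
  conv_lhs => rw [← Finset.insert_erase hk]
  rw [diagLength_insert (Finset.notMem_erase _ _), diagLength_insert h1]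
  split_ifs <;> omega

theorem balancedWords_erase_zero (S : Finset ℕ) :
    balancedWords (S.erase 0) = balancedWords S := by
  simp only [balancedWords, diagLength_erase_zero]

theorem balancedWords_empty : balancedWords ∅ = {[]} := by
  ext w
  simp only [balancedWords, diagLength, Finset.filter_empty, Finset.card_empty,
    Set.mem_ofPred_eq, Set.mem_singleton_iff]
  constructor
  · rintro ⟨h, -⟩
    exact List.eq_nil_iff_forall_not_mem.2 fun a => List.count_eq_zero.1 (h a)
  · rintro rfl
    refine ⟨by simp, fun u hu => ?_⟩
    rw [List.suffix_nil.1 hu]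
    simp [IsBalanced]

theorem cons_mem_balancedWords {S : Finset ℕ} (hS : 0 ∉ S) (k : ℕ) (u : List ℕ) :
    k :: u ∈ balancedWords S ↔
      (k + 1 ∈ S ∧ k ∉ S) ∧ u ∈ balancedWords (insert k (S.erase (k + 1))) := by
  constructor
  · rintro ⟨hc, hb⟩
    have hu : IsBalanced u := hb u (List.suffix_cons k u)
    simp only [List.count_cons, beq_iff_eq] at hc
    have hk : k + 1 ∈ S := by
      by_contra h
      have h1 := hc k
      have h2 := hc (k + 1)
      have h3 := diagLength_eq_succ S k
      have h4 := (hu k).1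
      simp [h] at h1 h2 h3
      omega
    have hk' : k ∉ S := by
      intro h
      obtain ⟨j, rfl⟩ : ∃ j, k = j + 1 := Nat.exists_eq_succ_of_ne_zero fun h0 => hS (h0 ▸ h)
      have h1 := hc j
      have h2 := hc (j + 1)
      have h3 := diagLength_eq_succ S j
      have h4 := (hu j).2
      simp [h] at h1 h2 h3
      omega
    refine ⟨⟨hk, hk'⟩, fun i => ?_, fun v hv => hb v (hv.trans (List.suffix_cons k u))⟩
    have := hc i
    rw [diagLength_move hk hk' i] at this
    omega
  · rintro ⟨⟨hk, hk'⟩, hc, hb⟩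
    have hc' : ∀ i, (k :: u).count i = diagLength S i := by
      intro i
      rw [diagLength_move hk hk' i, List.count_cons, hc i]
      simp
    refine ⟨hc', fun v hv => ?_⟩
    rcases List.suffix_cons_iff.1 hv with rfl | hv
    · intro i
      rw [hc', hc']
      have := diagLength_eq_succ S i
      split_ifs at this <;> omega
    · exact hb v hv

theorem balancedWords_eq_biUnion {S : Finset ℕ} (hS : 0 ∉ S) (hne : S.Nonempty) :
    balancedWords S = ⋃ s ∈ S.filter (fun s => s - 1 ∉ S),
      List.cons (s - 1) '' balancedWords (insert (s - 1) (S.erase s)) := by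
  ext w
  simp only [Set.mem_iUnion, Set.mem_image, Finset.mem_filter, exists_prop]
  constructor
  · intro hw
    cases w with
    | nil =>
      obtain ⟨s, hs⟩ := hne
      have h := hw.1 0
      simp only [List.count_nil, diagLength] at h
      have h' := Finset.card_eq_zero.1 h.symm
      exact absurd (Finset.mem_filter.2 ⟨hs, Nat.pos_of_ne_zero fun h0 => hS (h0 ▸ hs)⟩)
        (h' ▸ Finset.notMem_empty s)
    | cons k u =>
      obtain ⟨hk, hu⟩ := (cons_mem_balancedWords hS k u).1 hw
      exact ⟨k + 1, hk, u, hu, rfl⟩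
  · rintro ⟨s, ⟨hs, hs'⟩, u, hu, rfl⟩
    obtain ⟨k, rfl⟩ : ∃ k, s = k + 1 := Nat.exists_eq_succ_of_ne_zero fun h => hS (h ▸ hs)
    exact (cons_mem_balancedWords hS k u).2 ⟨⟨hs, hs'⟩, hu⟩

theorem balancedWords_finite_and_ncard (m : ℕ) (S : Finset ℕ) (hm : ∑ s ∈ S, s = m) :
    (balancedWords S).Finite ∧ ((balancedWords S).ncard : ℚ) = m.factorial * shiftedWeight S := by
  induction m generalizing S with
  | zero =>
    have h0 : S.erase 0 = ∅ := by
      ext s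
      simp only [Finset.mem_erase, Finset.notMem_empty, iff_false, not_and]
      exact fun h1 h2 => h1 (Finset.sum_eq_zero_iff.1 hm s h2)
    have hw : shiftedWeight S = 1 := by
      rcases (Finset.erase_eq_empty_iff S 0).1 h0 with rfl | rfl <;> simp [shiftedWeight]
    rw [← balancedWords_erase_zero, h0, balancedWords_empty, hw]
    simp
  | succ m ih =>
    wlog hS : 0 ∉ S generalizing S
    · have hins := Finset.insert_erase (not_not.1 hS)
      have h := this (S.erase 0) (by rwa [Finset.sum_erase S rfl]) (Finset.notMem_erase _ _)
      rwa [balancedWords_erase_zero, ← shiftedWeight_insert_zero (Finset.notMem_erase _ _),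
        hins] at h
    have hne : S.Nonempty := by
      rw [Finset.nonempty_iff_ne_empty]
      rintro rfl
      simp at hm
    have hstep : ∀ s ∈ S.filter (fun s => s - 1 ∉ S),
        (List.cons (s - 1) '' balancedWords (insert (s - 1) (S.erase s))).Finite ∧
        ((List.cons (s - 1) '' balancedWords (insert (s - 1) (S.erase s))).ncard : ℚ) =
          m.factorial * shiftedWeight (insert (s - 1) (S.erase s)) := by
      intro s hs
      obtain ⟨hs, hs'⟩ := Finset.mem_filter.1 hs
      have hpos : s ≠ 0 := fun h => hS (h ▸ hs)
      obtain ⟨hf, hc⟩ := ih (insert (s - 1) (S.erase s)) (by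
        rw [Finset.sum_insert fun h => hs' (Finset.mem_of_mem_erase h)]
        have := Finset.add_sum_erase S (fun s => s) hs
        omega)
      rw [Set.ncard_image_of_injective _ List.cons_injective]
      exact ⟨hf.image _, hc⟩
    have hfin : (balancedWords S).Finite := by
      rw [balancedWords_eq_biUnion hS hne]
      exact Set.Finite.biUnion (Finset.finite_toSet _) fun s hs => (hstep s hs).1
    refine ⟨hfin, ?_⟩
    have hdisj : (S.filter (fun s => s - 1 ∉ S) : Set ℕ).PairwiseDisjoint fun s =>
        List.cons (s - 1) '' balancedWords (insert (s - 1) (S.erase s)) := by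
      intro s hs t ht hst
      refine Set.disjoint_left.2 ?_
      rintro _ ⟨u, -, rfl⟩ ⟨v, -, huv⟩
      have hs0 : s ≠ 0 := fun h => hS (h ▸ (Finset.mem_filter.1 hs).1)
      have ht0 : t ≠ 0 := fun h => hS (h ▸ (Finset.mem_filter.1 ht).1)
      have := (List.cons_eq_cons.1 huv).1
      omega
    have hcard := (Finset.finite_toSet _).ncard_biUnion (fun s hs => (hstep s hs).1) hdisj
    rw [finsum_mem_coe_finset] at hcard
    simp only [Finset.mem_coe] at hcard
    rw [balancedWords_eq_biUnion hS hne, hcard, Nat.cast_sum,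
      Finset.sum_congr rfl fun s hs => (hstep s hs).2, ← Finset.mul_sum,
      sum_shiftedWeight_move hS, ← Nat.cast_sum, hm, Nat.factorial_succ]
    push_cast
    ring

section Count

variable {P Q : ℕ → Prop} [DecidablePred P] [DecidablePred Q]

theorem existsUnique_between_iff_count {p q : ℕ} (hpq : p < q) :
    (∃! r, p < r ∧ r < q ∧ Q r) ↔ Nat.count Q q = Nat.count Q (p + 1) + 1 := by
  obtain ⟨k, rfl⟩ := Nat.exists_eq_add_of_le (Nat.succ_le_of_lt hpq)
  rw [Nat.succ_eq_add_one, Nat.count_add, Nat.add_left_cancel_iff, Nat.count_eq_card_filter_range,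
    Finset.card_eq_one]
  constructor
  · rintro ⟨r, ⟨h1, h2, h3⟩, hr⟩
    obtain ⟨a, rfl⟩ := Nat.exists_eq_add_of_le (Nat.succ_le_of_lt h1)
    refine ⟨a, Finset.ext fun x => ?_⟩
    simp only [Finset.mem_filter, Finset.mem_range, Finset.mem_singleton]
    constructor
    · rintro ⟨hx, hQ⟩
      have := hr (p + 1 + x) ⟨by omega, by omega, hQ⟩
      omega
    · rintro rfl
      exact ⟨by omega, h3⟩
  · rintro ⟨a, ha⟩
    simp only [Finset.ext_iff, Finset.mem_filter, Finset.mem_range, Finset.mem_singleton] at ha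
    obtain ⟨h1, h2⟩ := (ha a).2 rfl
    refine ⟨p + 1 + a, ⟨by omega, by omega, h2⟩, ?_⟩
    rintro r ⟨h3, h4, h5⟩
    obtain ⟨b, rfl⟩ := Nat.exists_eq_add_of_le (Nat.succ_le_of_lt h3)
    rw [(ha b).1 ⟨by omega, h5⟩]

theorem exists_last_of_count_pos {t : ℕ} (ht : 0 < Nat.count P t) :
    ∃ p < t, P p ∧ (∀ r, p < r → r < t → ¬P r) ∧ Nat.count P t = Nat.count P p + 1 := by
  induction t with
  | zero => simp at ht
  | succ t ih =>
    by_cases h : P t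
    · exact ⟨t, t.lt_succ_self, h, fun r h1 h2 => by omega, Nat.count_succ_eq_succ_count h⟩
    · rw [Nat.count_succ_eq_count h] at ht ⊢
      obtain ⟨p, hp, hP, hr, hc⟩ := ih ht
      refine ⟨p, hp.trans t.lt_succ_self, hP, fun r h1 h2 => ?_, hc⟩
      rcases Nat.lt_succ_iff_lt_or_eq.1 h2 with h2 | rfl
      · exact hr r h1 h2
      · exact h

theorem exists_next_of_count_lt {t N : ℕ} (ht : Nat.count P t < Nat.count P N) :
    ∃ q, t ≤ q ∧ q < N ∧ P q ∧ Nat.count P q = Nat.count P t := by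
  induction N with
  | zero => simp at ht
  | succ N ih =>
    by_cases h : Nat.count P t < Nat.count P N
    · obtain ⟨q, h1, h2, h3⟩ := ih h
      exact ⟨q, h1, h2.trans N.lt_succ_self, h3⟩
    · have h1 := Nat.lt_of_count_lt_count ht
      have h2 := Nat.count_monotone P (Nat.lt_succ_iff.1 h1)
      rw [Nat.count_succ] at ht
      split_ifs at ht with hN
      · exact ⟨N, by omega, N.lt_succ_self, hN, by omega⟩
      · omega

theorem count_add_count_of_interlaced {N : ℕ}
    (h : ∀ p q, p < q → q < N → P p → P q → (∀ r, p < r → r < q → ¬P r) →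
      Nat.count Q q = Nat.count Q p + 1) {p q : ℕ} (hpq : p ≤ q) (hq : q < N) (hPp : P p)
    (hPq : P q) : Nat.count Q q + Nat.count P p = Nat.count Q p + Nat.count P q := by
  induction q using Nat.strong_induction_on with
  | _ q ih =>
    rcases hpq.eq_or_lt with rfl | hlt
    · rfl
    obtain ⟨m, hm, hPm, hgap, hc⟩ :=
      exists_last_of_count_pos ((Nat.zero_le _).trans_lt (Nat.count_strict_mono hPp hlt))
    have hpm : p ≤ m := not_lt.1 fun hmp => hgap p hmp hlt hPp
    have h1 := ih m hm hpm (hm.trans hq) hPm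
    have h2 := h m q hm hq hPm hPq hgap
    omega

theorem count_eq_count_of_interlaced {N : ℕ} (htot : Nat.count P N = Nat.count Q N + 1)
    (h : ∀ p q, p < q → q < N → P p → P q → (∀ r, p < r → r < q → ¬P r) →
      Nat.count Q q = Nat.count Q p + 1) {q : ℕ} (hq : q < N) (hPq : P q) :
    Nat.count Q q = Nat.count P q := by
  obtain ⟨a, -, haN, hPa, ha⟩ := exists_next_of_count_lt (P := P) (t := 0) (N := N)
    (by rw [Nat.count_zero]; omega)
  obtain ⟨l, hlN, hPl, hgap, hl⟩ := exists_last_of_count_pos (P := P) (t := N) (by omega)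
  rw [Nat.count_zero] at ha
  have haq : a ≤ q := not_lt.1 fun hqa => by
    have := Nat.count_strict_mono hPq hqa
    omega
  have hql : q ≤ l := not_lt.1 fun hlq => hgap q hlq hq hPq
  have h1 := count_add_count_of_interlaced h haq hq hPa hPq
  have h2 := count_add_count_of_interlaced h hql hlN hPq hPl
  have h3 := Nat.count_monotone Q hlN.le
  omega

theorem balanced_of_interlaced {N : ℕ} (htot : Nat.count P N = Nat.count Q N + 1)
    (h : ∀ p q, p < q → q < N → P p → P q → (∀ r, p < r → r < q → ¬P r) →
      Nat.count Q q = Nat.count Q p + 1) {t : ℕ} (ht : t ≤ N) :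
    Nat.count Q t ≤ Nat.count P t ∧ Nat.count P t ≤ Nat.count Q t + 1 := by
  have hQ := Nat.count_monotone Q ht
  constructor
  · by_cases hlt : Nat.count P t < Nat.count P N
    · obtain ⟨q, htq, hqN, hPq, hc⟩ := exists_next_of_count_lt hlt
      have h1 := count_eq_count_of_interlaced htot h hqN hPq
      have h2 := Nat.count_monotone Q htq
      omega
    · omega
  · rcases Nat.eq_zero_or_pos (Nat.count P t) with h0 | h0
    · omega
    · obtain ⟨p, hpt, hPp, -, hc⟩ := exists_last_of_count_pos h0
      have h1 := count_eq_count_of_interlaced htot h (hpt.trans_le ht) hPp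
      have h2 := Nat.count_monotone Q hpt.le
      omega

theorem interlaced_of_balanced (hd : ∀ r, P r → ¬Q r) {N : ℕ}
    (hb : ∀ t ≤ N, Nat.count Q t ≤ Nat.count P t ∧ Nat.count P t ≤ Nat.count Q t + 1)
    {p q : ℕ} (hpq : p < q) (hq : q < N) (hPp : P p) (hPq : P q)
    (hgap : ∀ r, p < r → r < q → ¬P r) : Nat.count Q q = Nat.count Q p + 1 := by
  have h1 : Nat.count P q = Nat.count P (p + 1) := by
    refine le_antisymm (not_lt.1 fun hlt => ?_) (Nat.count_monotone P hpq)
    obtain ⟨r, ⟨hr1, hr2⟩, hr⟩ := Nat.exists_of_count_lt_count hlt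
    exact hgap r hr1 hr2 hr
  have h2 := Nat.count_succ_eq_succ_count hPp
  have h3 := Nat.count_succ_eq_succ_count hPq
  have h4 := Nat.count_succ_eq_count (hd p hPp)
  have h5 := Nat.count_succ_eq_count (hd q hPq)
  have h6 := hb p (by omega)
  have h7 := hb (p + 1) (by omega)
  have h8 := hb q (by omega)
  have h9 := hb (q + 1) (by omega)
  omega

end Count

theorem count_take_eq_natCount (w : List ℕ) (a t : ℕ) :
    (w.take t).count a = Nat.count (fun r => w[r]? = some a) t := by
  induction t with
  | zero => simp
  | succ t ih =>
    rw [List.take_add_one, List.count_append, ih, Nat.count_succ]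
    congr 1
    cases w[t]? with
    | none => simp
    | some b => simp [List.count_singleton]

theorem count_eq_natCount (w : List ℕ) (a : ℕ) :
    w.count a = Nat.count (fun r => w[r]? = some a) w.length := by
  rw [← count_take_eq_natCount, List.take_length]

theorem interlaced_iff_count (w : List ℕ) (i : ℕ) :
    (∀ p q : Fin w.length, p < q → w.get p = i → w.get q = i →
      (∀ r : Fin w.length, p < r → r < q → w.get r ≠ i) →
      ∃! r : Fin w.length, p < r ∧ r < q ∧ w.get r = i + 1) ↔
    ∀ p q : ℕ, p < q → q < w.length → w[p]? = some i → w[q]? = some i →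
      (∀ r, p < r → r < q → ¬w[r]? = some i) →
      Nat.count (fun r => w[r]? = some (i + 1)) q =
        Nat.count (fun r => w[r]? = some (i + 1)) p + 1 := by
  have hget : ∀ (r : Fin w.length) (a : ℕ), w.get r = a ↔ w[(r : ℕ)]? = some a := by
    intro r a
    simp
  have huniq : ∀ p q : ℕ, p < q → q < w.length → w[p]? = some i →
      ((∃! r : Fin w.length, p < r ∧ r < q ∧ w.get r = i + 1) ↔
        Nat.count (fun r => w[r]? = some (i + 1)) q =
          Nat.count (fun r => w[r]? = some (i + 1)) p + 1) := by
    intro p q hpq hq hp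
    rw [← Nat.count_succ_eq_count (p := fun r => w[r]? = some (i + 1)) (n := p) (by simp [hp]),
      ← existsUnique_between_iff_count hpq]
    constructor
    · rintro ⟨r, ⟨h1, h2, h3⟩, hr⟩
      refine ⟨r, ⟨h1, h2, (hget _ _).1 h3⟩, ?_⟩
      rintro s ⟨h4, h5, h6⟩
      exact congrArg Fin.val (hr ⟨s, h5.trans hq⟩ ⟨h4, h5, (hget _ _).2 h6⟩)
    · rintro ⟨r, ⟨h1, h2, h3⟩, hr⟩
      refine ⟨⟨r, h2.trans hq⟩, ⟨h1, h2, (hget _ _).2 h3⟩, ?_⟩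
      rintro s ⟨h4, h5, h6⟩
      exact Fin.ext (hr s ⟨h4, h5, (hget _ _).1 h6⟩)
  constructor
  · intro h p q hpq hq hp hq' hgap
    rw [← huniq p q hpq hq hp]
    exact h ⟨p, hpq.trans hq⟩ ⟨q, hq⟩ hpq ((hget _ _).2 hp) ((hget _ _).2 hq')
      fun r h1 h2 h3 => hgap r h1 h2 ((hget _ _).1 h3)
  · intro h p q hpq hp hq hgap
    refine (huniq p q hpq q.2 ((hget _ _).1 hp)).2 (h p q hpq q.2 ((hget _ _).1 hp)
      ((hget _ _).1 hq) fun r h1 h2 h3 => ?_)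
    exact hgap ⟨r, h2.trans q.2⟩ h1 h2 ((hget _ _).2 h3)

theorem forall_suffix_reverse_isBalanced_iff (w : List ℕ) :
    (∀ u, u <:+ w.reverse → IsBalanced u) ↔ ∀ t ≤ w.length, IsBalanced (w.take t) := by
  constructor
  · intro h t _ i
    have := h (w.take t).reverse (List.reverse_suffix.2 (List.take_prefix t w)) i
    simpa only [List.count_reverse] using this
  · intro h u hu i
    have hp : u.reverse <+: w := by
      rw [← List.reverse_suffix, List.reverse_reverse]
      exact hu
    have := h u.reverse.length hp.length_le i
    rw [← List.prefix_iff_eq_take.1 hp] at this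
    simpa only [List.count_reverse] using this

theorem diagLength_Icc (n i : ℕ) : diagLength (Finset.Icc 1 n) i = n - i := by
  have h : (Finset.Icc 1 n).filter (i < ·) = Finset.Ioc i n := by
    ext
    simp
    omega
  rw [diagLength, h, Nat.card_Ioc]

theorem length_of_count {n : ℕ} {w : List ℕ} (h : ∀ i, w.count i = n - i) :
    w.length = n * (n + 1) / 2 := by
  have hsub : w.toFinset ⊆ Finset.range n := by
    intro a ha
    have := List.count_pos_iff.2 (List.mem_toFinset.1 ha)
    rw [h] at this
    simp
    omega
  rw [← List.sum_toFinset_count_eq_length, Finset.sum_subset hsub fun a _ ha =>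
    List.count_eq_zero.2 fun h' => ha (List.mem_toFinset.2 h'),
    Finset.sum_congr rfl fun i _ => h i]
  have h2 : ∑ i ∈ Finset.range n, (n - i) = ∑ i ∈ Finset.range (n + 1), i := by
    rw [← Finset.sum_range_reflect _ (n + 1), Finset.sum_range_succ]
    simp
  rw [h2, Finset.sum_range_id, Nat.add_sub_cancel, mul_comm]

theorem isSymbolicSequence_iff_reverse_mem (n : ℕ) (w : List ℕ) :
    IsSymbolicSequence n w ↔ w.reverse ∈ balancedWords (Finset.Icc 1 n) := by
  have hmem : w.reverse ∈ balancedWords (Finset.Icc 1 n) ↔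
      (∀ i, w.count i = n - i) ∧ ∀ t ≤ w.length, IsBalanced (w.take t) := by
    rw [← forall_suffix_reverse_isBalanced_iff]
    simp only [balancedWords, Set.mem_ofPred_eq, List.count_reverse, diagLength_Icc]
  rw [hmem]
  simp only [IsBalanced, count_take_eq_natCount]
  constructor
  · rintro ⟨-, hlt, hcount, hint⟩
    have hc : ∀ i, w.count i = n - i := by
      intro i
      rcases lt_or_ge i n with hi | hi
      · exact hcount i hi
      · rw [List.count_eq_zero.2 fun h => (hlt i h).not_ge hi, Nat.sub_eq_zero_of_le hi]
    refine ⟨hc, fun t ht i => ?_⟩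
    have h1 := hc i
    have h2 := hc (i + 1)
    rw [count_eq_natCount] at h1 h2
    rcases lt_or_ge i n with hi | hi
    · exact balanced_of_interlaced (by omega) ((interlaced_iff_count w i).1 (hint i)) ht
    · have h3 := Nat.count_monotone (fun r => w[r]? = some i) ht
      have h4 := Nat.count_monotone (fun r => w[r]? = some (i + 1)) ht
      omega
  · rintro ⟨hc, hb⟩
    refine ⟨length_of_count hc, fun s hs => ?_, fun i _ => hc i, fun i => ?_⟩
    · have := List.count_pos_iff.2 hs
      rw [hc] at this
      omega
    · refine (interlaced_iff_count w i).2 fun p q hpq hq hp hq' hgap => ?_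
      exact interlaced_of_balanced (P := fun r => w[r]? = some i)
        (fun r hr => by simp [hr]) (fun t ht => hb t ht i) hpq hq hp hq' hgap

/-- The number `♭ₙ` of symbolic sequences for degree `n` equals
`(n(n+1)/2)! · (1!·2!·…·(n-1)!)/(1!·3!·…·(2n-1)!)`. -/
theorem count_symbolic_sequences (n : ℕ) :
    (({w : List ℕ | IsSymbolicSequence n w}.ncard : ℚ)) =
      (Nat.factorial (n * (n + 1) / 2) : ℚ) *
        (∏ k ∈ Finset.range n, (Nat.factorial k : ℚ)) /
        (∏ k ∈ Finset.range n, (Nat.factorial (2 * k + 1) : ℚ)) := by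
  have himage : {w : List ℕ | IsSymbolicSequence n w} =
      List.reverse '' balancedWords (Finset.Icc 1 n) := by
    ext w
    rw [Set.mem_ofPred_eq, isSymbolicSequence_iff_reverse_mem]
    exact ⟨fun h => ⟨_, h, w.reverse_reverse⟩, by rintro ⟨u, hu, rfl⟩; rwa [List.reverse_reverse]⟩
  have hsum : ∑ s ∈ Finset.Icc 1 n, s = n * (n + 1) / 2 := by
    rw [Finset.sum_subset (s₂ := Finset.range (n + 1)), Finset.sum_range_id, Nat.add_sub_cancel,
      mul_comm]
    · intro s hs
      simp at hs ⊢
      omega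
    · intro s hs hs'
      simp at hs hs'
      omega
  rw [himage, Set.ncard_image_of_injective _ List.reverse_injective,
    (balancedWords_finite_and_ncard _ _ hsum).2, shiftedWeight_Icc, mul_div_assoc]
end
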